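/- arXiv:2006.06774 — 2 statements merged into one kernel-verified Lean document; each statement's English description precedes it below -/
import Mathlib

section
/- Let Σ_A ⊆ Σ be an aperiodic and irreducible subshift of finite type and let (φ_i)_{i∈ℕ} be continuous potentials on Σ_A with uniformly decreasing variations. Then the map α ↦ h_top(L_A(α)) is upper semi-continuous (with the convention h_top(∅) = −∞). -/
open Filter Set
open scoped ENNReal

/-- The left shift on one-sided sequence spaces. -/
def shift {α : Type*} (x : ℕ → α) : ℕ → α := fun n => x (n + 1)

/-- The cylinder set determined by a finite word `w`. -/
def cyl {α : Type*} {n : ℕ} (w : Fin n → α) : Set (ℕ → α) :=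
  {x | ∀ k : Fin n, x (k : ℕ) = w k}

/-- Finite words over `α`, encoded with their length. -/
def Word (α : Type*) : Type _ := Σ n : ℕ, Fin n → α

/-- The length (level) of a word/cylinder. -/
def Word.len {α : Type*} (w : Word α) : ℕ := w.1

/-- The cylinder set of a word. -/
def Word.cylSet {α : Type*} (w : Word α) : Set (ℕ → α) := cyl w.2

/-- `H^s_r(E)`: infimum over covers of `E` by cylinders of level `> r` of
`∑ e^{-s·l(C)}`. -/
noncomputable def Hsr {α : Type*} (E : Set (ℕ → α)) (s : ℝ) (r : ℕ) : ℝ≥0∞ :=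
  ⨅ (S : Set (Word α)) (_ : ∀ w ∈ S, r < w.len) (_ : E ⊆ ⋃ w ∈ S, w.cylSet),
    ∑' w : S, ENNReal.ofReal (Real.exp (-s * ((w : Word α).len : ℝ)))

/-- `H^s(E) = lim_{r→∞} H^s_r(E)` (the quantities are nondecreasing in `r`). -/
noncomputable def Hentm {α : Type*} (E : Set (ℕ → α)) (s : ℝ) : ℝ≥0∞ :=
  ⨆ r : ℕ, Hsr E s r

open scoped Classical in
/-- Topological entropy of `E ⊆ Σ`, with the convention `htop ∅ = -∞`. -/
noncomputable def htop {α : Type*} (E : Set (ℕ → α)) : EReal :=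
  if E = ∅ then ⊥ else ((sInf {s : ℝ | 0 ≤ s ∧ Hentm E s ≠ ⊤} : ℝ) : EReal)

/-- The subshift of finite type determined by the 0-1 (Boolean) matrix `M`. -/
def SigmaA {K : ℕ} (M : Fin K → Fin K → Bool) : Set (ℕ → Fin K) :=
  {x | ∀ k : ℕ, M (x k) (x (k + 1)) = true}

/-- `Σ_A` is aperiodic and irreducible: some power of the adjacency matrix is
strictly positive, i.e. there is `r ≥ 1` such that any two symbols are joined
by an admissible path of length `r`. -/
def ApIrr {K : ℕ} (M : Fin K → Fin K → Bool) : Prop :=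
  ∃ r : ℕ, 0 < r ∧ ∀ i j : Fin K, ∃ p : ℕ → Fin K, p 0 = i ∧ p r = j ∧
    ∀ k < r, M (p k) (p (k + 1)) = true

/-- The (non-autonomous) Birkhoff average `(1/n) ∑_{k<n} φ_k(σ^k x)`. -/
noncomputable def birk {K : ℕ} (φ : ℕ → (ℕ → Fin K) → ℝ) (n : ℕ) (x : ℕ → Fin K) : ℝ :=
  (∑ k ∈ Finset.range n, φ k (shift^[k] x)) / n

/-- The sequence of potentials `φ` has uniformly decreasing variations on `Σ_A`:
`ρ_n := sup_i sup_{|𝐢|=n} sup_{𝐣,𝐤 ∈ [𝐢]} |φ_i(𝐣) - φ_i(𝐤)| → 0`. -/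
def UDV {K : ℕ} (M : Fin K → Fin K → Bool) (φ : ℕ → (ℕ → Fin K) → ℝ) : Prop :=
  ∀ ε > (0 : ℝ), ∃ N : ℕ, ∀ n ≥ N, ∀ i : ℕ, ∀ x ∈ SigmaA M, ∀ y ∈ SigmaA M,
    (∀ k < n, x k = y k) → |φ i x - φ i y| < ε

/-- `L_A(α,β)`: points of `Σ_A` with lower Birkhoff average `α` and upper
Birkhoff average `β`. -/
def LAb {K : ℕ} (M : Fin K → Fin K → Bool) (φ : ℕ → (ℕ → Fin K) → ℝ) (a b : ℝ) :
    Set (ℕ → Fin K) :=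
  {x | x ∈ SigmaA M ∧ Filter.liminf (fun n => birk φ n x) Filter.atTop = a ∧
    Filter.limsup (fun n => birk φ n x) Filter.atTop = b}

/-- `L_A(α) = L_A(α,α)`. -/
def LA {K : ℕ} (M : Fin K → Fin K → Bool) (φ : ℕ → (ℕ → Fin K) → ℝ) (a : ℝ) :
    Set (ℕ → Fin K) := LAb M φ a a

/-- `L_A(α)` described via convergence of the Birkhoff averages. -/
def LAlim {K : ℕ} (M : Fin K → Fin K → Bool) (φ : ℕ → (ℕ → Fin K) → ℝ) (a : ℝ) :
    Set (ℕ → Fin K) :=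
  {x | x ∈ SigmaA M ∧ Tendsto (fun n => birk φ n x) atTop (nhds a)}

lemma ENNReal.quarter_add_quarter (a : ℝ≥0∞) : a / 4 + a / 4 = a / 2 := by
  have h : a / 4 = a / 2 / 2 := by
    rw [div_eq_mul_inv, div_eq_mul_inv, div_eq_mul_inv, mul_assoc,
      ← ENNReal.mul_inv (Or.inl (by norm_num)) (Or.inl (by norm_num))]
    norm_num
  rw [h, ENNReal.add_halves]

/-! ### Basic properties of the contents `Hsr` -/

/-- The weight `e^{-s·l(C)}` of the cylinder of a word. -/
noncomputable def Word.weight {α : Type*} (s : ℝ) (w : Word α) : ℝ≥0∞ :=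
  ENNReal.ofReal (Real.exp (-s * (w.len : ℝ)))

lemma Hsr_mono {α : Type*} {E F : Set (ℕ → α)} (h : E ⊆ F) (s : ℝ) (r : ℕ) :
    Hsr E s r ≤ Hsr F s r := by
  refine le_iInf fun S => le_iInf fun hS => le_iInf fun hF => ?_
  exact iInf_le_of_le S (iInf_le_of_le hS (iInf_le_of_le (h.trans hF) le_rfl))

lemma Hsr_le_tsum_subtype {α : Type*} {E : Set (ℕ → α)} (s : ℝ) {r : ℕ} (S : Set (Word α))
    (hS : ∀ w ∈ S, r < w.len) (hE : E ⊆ ⋃ w ∈ S, w.cylSet) :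
    Hsr E s r ≤ ∑' w : S, Word.weight s (w : Word α) :=
  iInf_le_of_le S (iInf_le_of_le hS (iInf_le_of_le hE le_rfl))

lemma Hsr_le_tsum {α ι : Type*} {E : Set (ℕ → α)} (s : ℝ) {r : ℕ} (f : ι → Word α)
    (hf : ∀ i, r < (f i).len) (hE : E ⊆ ⋃ i, (f i).cylSet) :
    Hsr E s r ≤ ∑' i, Word.weight s (f i) := by
  refine (Hsr_le_tsum_subtype s (range f) ?_ ?_).trans ?_
  · rintro _ ⟨i, rfl⟩
    exact hf i
  · simpa using hE
  · exact ENNReal.tsum_le_tsum_comp_of_surjective (rangeFactorization_surjective (f := f))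
      fun w : range f => Word.weight s (w : Word α)

lemma exists_cover_of_Hsr_lt {α : Type*} {E : Set (ℕ → α)} {s : ℝ} {r : ℕ} {c : ℝ≥0∞}
    (h : Hsr E s r < c) :
    ∃ S : Set (Word α), (∀ w ∈ S, r < w.len) ∧ (E ⊆ ⋃ w ∈ S, w.cylSet) ∧
      ∑' w : S, Word.weight s (w : Word α) < c := by
  simp only [Hsr, iInf_lt_iff] at h
  obtain ⟨S, hS, hE, h⟩ := h
  exact ⟨S, hS, hE, h⟩

lemma Hsr_iUnion_le {α ι : Type*} [Countable ι] (E : ι → Set (ℕ → α)) (s : ℝ) (r : ℕ) :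
    Hsr (⋃ i, E i) s r ≤ ∑' i, Hsr (E i) s r := by
  by_cases htop : ∑' i, Hsr (E i) s r = ⊤
  · rw [htop]; exact le_top
  refine ENNReal.le_of_forall_pos_le_add fun ε hε _ => ?_
  obtain ⟨δ, hδ, hδε⟩ := ENNReal.exists_pos_sum_of_countable' (ENNReal.coe_pos.2 hε).ne' ι
  have hcov : ∀ i, ∃ S : Set (Word α), (∀ w ∈ S, r < w.len) ∧ (E i ⊆ ⋃ w ∈ S, w.cylSet) ∧
      ∑' w : S, Word.weight s (w : Word α) < Hsr (E i) s r + δ i := fun i =>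
    exists_cover_of_Hsr_lt
      (ENNReal.lt_add_right (ENNReal.ne_top_of_tsum_ne_top htop i) (hδ i).ne')
  choose S hS hE hlt using hcov
  calc Hsr (⋃ i, E i) s r ≤ ∑' w : ⋃ i, S i, Word.weight s (w : Word α) := by
        refine Hsr_le_tsum_subtype s _ ?_ ?_
        · intro w hw
          obtain ⟨i, hi⟩ := mem_iUnion.1 hw
          exact hS i w hi
        · refine iUnion_subset fun i => (hE i).trans ?_
          exact biUnion_subset_biUnion_left (subset_iUnion S i)
    _ ≤ ∑' i, ∑' w : S i, Word.weight s (w : Word α) := ENNReal.tsum_iUnion_le_tsum _ _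
    _ ≤ ∑' i, (Hsr (E i) s r + δ i) := ENNReal.tsum_le_tsum fun i => (hlt i).le
    _ = ∑' i, Hsr (E i) s r + ∑' i, δ i := ENNReal.tsum_add
    _ ≤ ∑' i, Hsr (E i) s r + ε := by gcongr

lemma Hsr_union_le {α : Type*} (E F : Set (ℕ → α)) (s : ℝ) (r : ℕ) :
    Hsr (E ∪ F) s r ≤ Hsr E s r + Hsr F s r := by
  have h := Hsr_iUnion_le (fun b : Bool => cond b E F) s r
  rw [← union_eq_iUnion, tsum_fintype] at h
  simpa using h

@[simp] lemma Hsr_empty {α : Type*} (s : ℝ) (r : ℕ) : Hsr (∅ : Set (ℕ → α)) s r = 0 := by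
  simpa using Hsr_le_tsum_subtype (E := (∅ : Set (ℕ → α))) s (r := r) ∅ (by simp) (by simp)

lemma nonempty_of_Hsr_pos {α : Type*} {E : Set (ℕ → α)} {s : ℝ} {r : ℕ} (h : 0 < Hsr E s r) :
    E.Nonempty := by
  by_contra! hE
  simp [hE] at h

lemma Hsr_cyl_le {α : Type*} {n : ℕ} (w : Fin n → α) (s : ℝ) {r : ℕ} (hr : r < n) :
    Hsr (cyl w) s r ≤ ENNReal.ofReal (Real.exp (-s * n)) := by
  refine (Hsr_le_tsum (ι := Unit) s (fun _ => ⟨n, w⟩) (fun _ => hr)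
    fun _ hx => mem_iUnion.2 ⟨(), hx⟩).trans ?_
  rw [tsum_fintype, Fintype.sum_unique]
  rfl

/-- The cylinder of level `n` around a point. -/
def nbhdCyl {α : Type*} (x : ℕ → α) (n : ℕ) : Set (ℕ → α) := {y | ∀ i < n, y i = x i}

lemma nbhdCyl_eq_cyl {α : Type*} (x : ℕ → α) (n : ℕ) :
    nbhdCyl x n = cyl fun i : Fin n => x i := by
  ext y
  exact ⟨fun h k => h k k.2, fun h i hi => h ⟨i, hi⟩⟩

lemma Hsr_inter_nbhdCyl_le_one {α : Type*} (E : Set (ℕ → α)) (x : ℕ → α) {s : ℝ} (hs : 0 ≤ s)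
    {r n : ℕ} (hr : r < n) : Hsr (E ∩ nbhdCyl x n) s r ≤ 1 := by
  refine (Hsr_mono inter_subset_right s r).trans ?_
  rw [nbhdCyl_eq_cyl]
  refine (Hsr_cyl_le _ s hr).trans ?_
  rw [ENNReal.ofReal_le_one, Real.exp_le_one_iff]
  have : 0 ≤ s * n := by positivity
  linarith

/-- A set of positive content meets some cylinder of any given level in positive content. -/
lemma exists_Hsr_inter_nbhdCyl_pos {α : Type*} [Countable α] {E : Set (ℕ → α)} {s : ℝ} {r : ℕ}
    (h : 0 < Hsr E s r) (n : ℕ) : ∃ x ∈ E, 0 < Hsr (E ∩ nbhdCyl x n) s r := by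
  by_contra! hE
  have hsub : E ⊆ ⋃ u : Fin n → α, E ∩ cyl u := fun x hx =>
    mem_iUnion.2 ⟨fun i => x i, hx, fun _ => rfl⟩
  have hle := (Hsr_mono hsub s r).trans (Hsr_iUnion_le _ s r)
  have hzero : ∀ u : Fin n → α, Hsr (E ∩ cyl u) s r = 0 := by
    intro u
    rcases (E ∩ cyl u).eq_empty_or_nonempty with hu | ⟨x, hx, hxu⟩
    · rw [hu, Hsr_empty]
    · have : cyl u = nbhdCyl x n := by
        rw [nbhdCyl_eq_cyl]
        congr 1
        exact funext fun i => (hxu i).symm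
      rw [this]
      exact nonpos_iff_eq_zero.1 (hE x hx)
  simp only [hzero, tsum_zero] at hle
  exact absurd h hle.not_gt

/-! ### Colouring the cylinders of a set -/

/-- The points of `Σ` whose block at positions `n, …, n + N - 1` is `c.1` and whose cylinder of
level `n + N` meets `E` in content between `e^{-ε n (c.2 + 1)}` and `e^{-ε n c.2}`. -/
def colorClass {α : Type*} (E : Set (ℕ → α)) (s : ℝ) (r N B : ℕ) (ε : ℝ) (n : ℕ)
    (c : (Fin N → α) × Fin (B + 1)) : Set (ℕ → α) :=
  {x | (∀ i : Fin N, x (n + i) = c.1 i) ∧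
    ENNReal.ofReal (Real.exp (-(ε * n * ((c.2 : ℕ) + 1)))) ≤ Hsr (E ∩ nbhdCyl x (n + N)) s r ∧
    Hsr (E ∩ nbhdCyl x (n + N)) s r ≤ ENNReal.ofReal (Real.exp (-(ε * n * (c.2 : ℕ))))}

lemma exists_exp_bin {ε : ℝ} {n B : ℕ} {H : ℝ≥0∞} (h1 : H ≤ 1)
    (hB : ENNReal.ofReal (Real.exp (-(ε * n * (B + 1)))) ≤ H) :
    ∃ i : Fin (B + 1), ENNReal.ofReal (Real.exp (-(ε * n * ((i : ℕ) + 1)))) ≤ H ∧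
      H ≤ ENNReal.ofReal (Real.exp (-(ε * n * (i : ℕ)))) := by
  classical
  have hex : ∃ i : ℕ, ENNReal.ofReal (Real.exp (-(ε * n * ((i : ℝ) + 1)))) ≤ H := ⟨B, hB⟩
  refine ⟨⟨Nat.find hex, Nat.lt_succ_of_le (Nat.find_min' hex hB)⟩, Nat.find_spec hex, ?_⟩
  rcases (Nat.find hex).eq_zero_or_eq_succ_pred with hi | hi
  · simpa only [hi, Nat.cast_zero, mul_zero, neg_zero, Real.exp_zero, ENNReal.ofReal_one] using h1
  · have := Nat.find_min hex (m := (Nat.find hex).pred) (by omega)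
    push Not at this
    rw [← Nat.cast_succ, ← hi] at this
    exact this.le

lemma Hsr_le_sum_colorClass {α : Type*} [Fintype α] {E G : Set (ℕ → α)} (hG : G ⊆ E) {s : ℝ}
    (hs : 0 ≤ s) {r n : ℕ} (N B : ℕ) (ε : ℝ) (hr : r < n + N) :
    Hsr G s r ≤ ∑ c, Hsr (G ∩ colorClass E s r N B ε n c) s r +
      (Fintype.card α : ℝ≥0∞) ^ (n + N) * ENNReal.ofReal (Real.exp (-(ε * n * (B + 1)))) := by
  classical
  set e := ENNReal.ofReal (Real.exp (-(ε * n * (B + 1)))) with he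
  let D : (Fin (n + N) → α) → Set (ℕ → α) := fun u =>
    {x | x ∈ E ∩ cyl u ∧ Hsr (E ∩ nbhdCyl x (n + N)) s r < e}
  have hsub : G ⊆ (⋃ c, G ∩ colorClass E s r N B ε n c) ∪ ⋃ u, D u := by
    intro x hx
    by_cases hxe : Hsr (E ∩ nbhdCyl x (n + N)) s r < e
    · exact Or.inr (mem_iUnion.2 ⟨fun i => x i, ⟨hG hx, fun _ => rfl⟩, hxe⟩)
    · obtain ⟨i, hi⟩ := exists_exp_bin (ε := ε) (n := n) (B := B)
        (Hsr_inter_nbhdCyl_le_one E x hs hr) (not_lt.1 hxe)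
      exact Or.inl (mem_iUnion.2 ⟨(fun j => x (n + j), i), hx, fun _ => rfl, hi⟩)
  have hD : ∀ u, Hsr (D u) s r ≤ e := by
    intro u
    rcases (D u).eq_empty_or_nonempty with hu | ⟨x, ⟨-, hxu⟩, hlt⟩
    · rw [hu, Hsr_empty]; exact zero_le
    · refine (Hsr_mono ?_ s r).trans hlt.le
      rintro y ⟨⟨hyE, hyu⟩, -⟩
      exact ⟨hyE, fun i hi => (hyu ⟨i, hi⟩).trans (hxu ⟨i, hi⟩).symm⟩
  calc Hsr G s r ≤ _ := Hsr_mono hsub s r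
    _ ≤ Hsr (⋃ c, G ∩ colorClass E s r N B ε n c) s r + Hsr (⋃ u, D u) s r :=
        Hsr_union_le _ _ _ _
    _ ≤ ∑ c, Hsr (G ∩ colorClass E s r N B ε n c) s r + ∑ u, Hsr (D u) s r := by
        rw [← tsum_fintype (L := .unconditional _), ← tsum_fintype (L := .unconditional _)]
        exact add_le_add (Hsr_iUnion_le _ _ _) (Hsr_iUnion_le _ _ _)
    _ ≤ _ := by
        gcongr
        refine (Finset.sum_le_card_nsmul _ _ e fun u _ => hD u).trans ?_
        simp

/-- Along an ultrafilter of levels, some colour carries a definite proportion of the content. -/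
lemma exists_color_eventually {α : Type*} [Fintype α] {E G : Set (ℕ → α)} (hG : G ⊆ E) {s : ℝ}
    (hs : 0 ≤ s) {r : ℕ} {N B : ℕ} {ε : ℝ} {κ : ℝ≥0∞}
    (hB : (Fintype.card α : ℝ) * Real.exp (-(ε * (B + 1))) ≤ 1 / 2)
    (hκ : (Fintype.card ((Fin N → α) × Fin (B + 1)) : ℝ≥0∞) * κ ≤ 1 / 4)
    (h0 : Hsr G s r ≠ 0) (htop : Hsr G s r ≠ ⊤) :
    ∃ c, ∀ᶠ n in (hyperfilter ℕ : Filter ℕ),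
      κ * Hsr G s r ≤ Hsr (G ∩ colorClass E s r N B ε n c) s r := by
  by_contra! hcon
  set H := Hsr G s r
  have hcon' : ∀ᶠ n in (hyperfilter ℕ : Filter ℕ), ∀ c,
      Hsr (G ∩ colorClass E s r N B ε n c) s r < κ * H := eventually_all.2 hcon
  have hsmall : ∀ᶠ n : ℕ in atTop,
      ENNReal.ofReal ((Fintype.card α : ℝ) ^ N * (1 / 2) ^ n) < H / 4 := by
    have hlim : Tendsto (fun n : ℕ => ENNReal.ofReal ((Fintype.card α : ℝ) ^ N * (1 / 2) ^ n))
        atTop (nhds 0) := by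
      have := (tendsto_pow_atTop_nhds_zero_of_lt_one (r := (1 / 2 : ℝ)) (by norm_num)
        (by norm_num)).const_mul ((Fintype.card α : ℝ) ^ N)
      simpa using ENNReal.tendsto_ofReal this
    exact hlim.eventually_lt_const (ENNReal.div_pos h0 (by norm_num))
  obtain ⟨n, hn, hsm, hrn⟩ := (hcon'.and
    (Nat.hyperfilter_le_atTop (hsmall.and (eventually_gt_atTop r)))).exists
  have hexp : (Fintype.card α : ℝ≥0∞) ^ (n + N) *
      ENNReal.ofReal (Real.exp (-(ε * n * (B + 1)))) ≤
      ENNReal.ofReal ((Fintype.card α : ℝ) ^ N * (1 / 2) ^ n) := by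
    rw [← ENNReal.ofReal_natCast, ← ENNReal.ofReal_pow (by positivity),
      ← ENNReal.ofReal_mul (by positivity)]
    apply ENNReal.ofReal_le_ofReal
    have : Real.exp (-(ε * n * (B + 1))) = Real.exp (-(ε * (B + 1))) ^ n := by
      rw [← Real.exp_nat_mul]; congr 1; ring
    calc (Fintype.card α : ℝ) ^ (n + N) * Real.exp (-(ε * n * (B + 1)))
        = (Fintype.card α : ℝ) ^ N * ((Fintype.card α : ℝ) * Real.exp (-(ε * (B + 1)))) ^ n := by
          rw [this, mul_pow, pow_add]; ring
      _ ≤ _ := by gcongr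
  have hle := Hsr_le_sum_colorClass hG hs (r := r) (n := n) N B ε (by omega)
  have : H ≤ H / 4 + H / 4 := by
    refine hle.trans (add_le_add ?_ (hexp.trans hsm.le))
    refine (Finset.sum_le_card_nsmul _ _ (κ * H) fun c _ => (hn c).le).trans ?_
    rw [nsmul_eq_mul, Finset.card_univ, ← mul_assoc]
    refine (mul_le_mul_left hκ H).trans ?_
    rw [mul_comm, mul_one_div]
  have hlt : H / 4 + H / 4 < H := by
    rw [ENNReal.quarter_add_quarter]
    exact ENNReal.half_lt_self h0 htop
  exact absurd this hlt.not_ge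

/-! ### Splicing points while avoiding a cover -/

/-- The point that follows `w` up to position `L` and `y` afterwards. -/
def splice {α : Type*} (w y : ℕ → α) (L : ℕ) : ℕ → α := fun i => if i < L then w i else y i

/-- The words of `S` of level at least `L` that extend the initial word of length `L` of `w`. -/
def extWords {α : Type*} (S : Set (Word α)) (w : ℕ → α) (L : ℕ) : Set (Word α) :=
  {v | v ∈ S ∧ L ≤ v.len ∧ ∀ i : Fin v.1, (i : ℕ) < L → v.2 i = w i}

/-- The total weight of the words of `S` that extend the initial word of length `L` of `w`. -/
noncomputable def extWeight {α : Type*} (S : Set (Word α)) (s : ℝ) (w : ℕ → α) (L : ℕ) : ℝ≥0∞ :=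
  ∑' v : extWords S w L, Word.weight s (v : Word α)

lemma Hsr_splice_mem_le {α : Type*} (S : Set (Word α)) {s s' : ℝ} (hss : s ≤ s') {r n L : ℕ}
    (hn : n ≤ L) (hr : r < L) (w z : ℕ → α) :
    Hsr {y | y ∈ nbhdCyl z L ∧ ∃ v ∈ extWords S w L, splice w y L ∈ v.cylSet} s' r ≤
      ENNReal.ofReal (Real.exp (-((s' - s) * n))) * extWeight S s w L := by
  refine (Hsr_le_tsum (ι := extWords S w L) s'
    (fun v => ⟨v.1.1, fun i => if (i : ℕ) < L then z i else v.1.2 i⟩) ?_ ?_).trans ?_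
  · exact fun v => hr.trans_le v.2.2.1
  · rintro y ⟨hy, v, hv, hyv⟩
    refine mem_iUnion.2 ⟨⟨v, hv⟩, fun i => ?_⟩
    have := hyv i
    by_cases hi : (i : ℕ) < L
    · simpa [hi] using hy i hi
    · simpa [splice, hi] using this
  · rw [extWeight, ← ENNReal.tsum_mul_left]
    refine ENNReal.tsum_le_tsum fun v => ?_
    unfold Word.weight
    rw [← ENNReal.ofReal_mul (Real.exp_nonneg _), ← Real.exp_add]
    refine ENNReal.ofReal_le_ofReal (Real.exp_le_exp.2 ?_)
    have h1 : (n : ℝ) ≤ (v : Word α).len := by exact_mod_cast hn.trans v.2.2.1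
    have h2 := mul_le_mul_of_nonneg_left h1 (sub_nonneg.2 hss)
    change -s' * ((v : Word α).len : ℝ) ≤ _
    linarith

lemma Hsr_extWeight_gt_le {α : Type*} [Fintype α] (E : Set (ℕ → α)) (S : Set (Word α))
    (s s' a : ℝ) (r : ℕ) {L L' : ℕ} (hL : L ≤ L') (w z : ℕ → α) :
    Hsr {y | y ∈ E ∩ nbhdCyl z L ∧ ENNReal.ofReal (Real.exp a) * Hsr (E ∩ nbhdCyl y L') s' r <
        extWeight S s (splice w y L) L'} s' r ≤
      ENNReal.ofReal (Real.exp (-a)) * extWeight S s w L := by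
  classical
  set Bad := {y | y ∈ E ∩ nbhdCyl z L ∧ ENNReal.ofReal (Real.exp a) *
    Hsr (E ∩ nbhdCyl y L') s' r < extWeight S s (splice w y L) L'}
  let P : (Fin L' → α) → Word α → Prop := fun u v =>
    L' ≤ v.len ∧ ∀ (i : Fin v.1) (h : (i : ℕ) < L'), v.2 i = u ⟨i, h⟩
  let D : (Fin L' → α) → Set (ℕ → α) := fun u => {y | y ∈ Bad ∧ ∀ i : Fin L', splice w y L i = u i}
  have hsub : Bad ⊆ ⋃ u, D u := fun y hy => mem_iUnion.2 ⟨fun i => splice w y L i, hy, fun _ => rfl⟩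
  have hD : ∀ u, Hsr (D u) s' r ≤ ENNReal.ofReal (Real.exp (-a)) *
      ∑' v : extWords S w L, if P u v then Word.weight s (v : Word α) else 0 := by
    intro u
    rcases (D u).eq_empty_or_nonempty with hu | ⟨x, hx, hxu⟩
    · rw [hu, Hsr_empty]; exact zero_le
    have h1 : D u ⊆ E ∩ nbhdCyl x L' := by
      rintro y ⟨hy, hyu⟩
      refine ⟨hy.1.1, fun i hi => ?_⟩
      by_cases hiL : i < L
      · rw [hy.1.2 i hiL, hx.1.2 i hiL]
      · simpa [splice, hiL] using (hyu ⟨i, hi⟩).trans (hxu ⟨i, hi⟩).symm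
    have h2 : extWeight S s (splice w x L) L' ≤
        ∑' v : extWords S w L, if P u v then Word.weight s (v : Word α) else 0 := by
      rw [extWeight, tsum_subtype,
        tsum_subtype (extWords S w L) fun v => if P u v then Word.weight s v else 0]
      refine ENNReal.tsum_le_tsum fun v => indicator_le (fun v hv => ?_) v
      have hv1 : v ∈ extWords S w L := by
        refine ⟨hv.1, hL.trans hv.2.1, fun i hi => ?_⟩
        simpa [splice, hi] using hv.2.2 i (hi.trans_le hL)
      have hv2 : P u v := ⟨hv.2.1, fun i hi => (hv.2.2 i hi).trans (hxu ⟨i, hi⟩)⟩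
      rw [indicator_of_mem hv1, if_pos hv2]
    calc Hsr (D u) s' r ≤ Hsr (E ∩ nbhdCyl x L') s' r := Hsr_mono h1 _ _
      _ = ENNReal.ofReal (Real.exp (-a)) *
          (ENNReal.ofReal (Real.exp a) * Hsr (E ∩ nbhdCyl x L') s' r) := by
        rw [← mul_assoc, ← ENNReal.ofReal_mul (Real.exp_nonneg _), ← Real.exp_add]
        simp
      _ ≤ _ := by gcongr; exact hx.2.le.trans h2
  have hP : ∀ v : Word α, ∑' u, (if P u v then Word.weight s v else 0) ≤ Word.weight s v := by
    intro v
    by_cases hv : L' ≤ v.len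
    · refine (ENNReal.tsum_le_tsum fun u => ?_).trans
        (tsum_ite_eq (fun i : Fin L' => v.2 ⟨i, i.2.trans_le hv⟩) fun _ => Word.weight s v).le
      split_ifs with h1 h2
      · exact le_rfl
      · exact absurd (funext fun i : Fin L' => (h1.2 ⟨i, i.2.trans_le hv⟩ i.2).symm) h2
      · exact zero_le
      · exact le_rfl
    · simp [P, hv]
  calc Hsr Bad s' r ≤ ∑' u, Hsr (D u) s' r := (Hsr_mono hsub _ _).trans (Hsr_iUnion_le _ _ _)
    _ ≤ ∑' u, ENNReal.ofReal (Real.exp (-a)) *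
        ∑' v : extWords S w L, if P u v then Word.weight s (v : Word α) else 0 :=
      ENNReal.tsum_le_tsum hD
    _ = ENNReal.ofReal (Real.exp (-a)) *
        ∑' v : extWords S w L, ∑' u, if P u v then Word.weight s (v : Word α) else 0 := by
      rw [ENNReal.tsum_mul_left, ENNReal.tsum_comm]
    _ ≤ _ := by
      unfold extWeight
      gcongr
      exact hP _

/-- The state of the splicing procedure at position `n`: the word `w` built so far is continued
like the point `z` of `F`, no word of `S` up to level `n + N` is initial in `w`, and the weight of
the part of `S` extending `w` is controlled by the content of `F` around `z`. -/
structure SpliceState {α : Type*} (S : Set (Word α)) (F : Set (ℕ → α)) (s s' : ℝ) (r N n : ℕ)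
    (w z : ℕ → α) : Prop where
  lt_level : r < n + N
  agree : ∀ i < N, w (n + i) = z (n + i)
  pos : 0 < Hsr (F ∩ nbhdCyl z (n + N)) s' r
  weight_le : extWeight S s w (n + N) ≤
    ENNReal.ofReal (Real.exp ((s' - s) / 2 * n)) * Hsr (F ∩ nbhdCyl z (n + N)) s' r
  notMem : ∀ v ∈ S, v.len ≤ n + N → w ∉ v.cylSet

lemma SpliceState.exists_next {α : Type*} [Fintype α] {S : Set (Word α)} {E F : Set (ℕ → α)}
    {s s' : ℝ} (hss : s < s') (hs' : 0 ≤ s') {r r' N B n : ℕ} {w z : ℕ → α} {κ : ℝ≥0∞}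
    (hst : SpliceState S E s s' r N n w z)
    (hB : (Fintype.card α : ℝ) * Real.exp (-((s' - s) / 4 * (B + 1))) ≤ 1 / 2)
    (hκ0 : κ ≠ 0) (hκ1 : κ ≠ ⊤)
    (hκ : (Fintype.card ((Fin N → α) × Fin (B + 1)) : ℝ≥0∞) * κ ≤ 1 / 4)
    (hn : ENNReal.ofReal (Real.exp (-((s' - s) / 2 * n))) ≤ κ / 4)
    (hcol : ∀ c,
      (∀ᶠ n in (hyperfilter ℕ : Filter ℕ),
        (E ∩ colorClass E s' r N B ((s' - s) / 4) n c).Nonempty) →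
      (∀ᶠ n in (hyperfilter ℕ : Filter ℕ),
        (F ∩ colorClass F s' r' N B ((s' - s) / 4) n c).Nonempty)) (m : ℕ) :
    ∃ n' ≥ m, ∃ y ∈ E, ∃ w' z', SpliceState S F s s' r' N n' w' z' ∧
      (∀ i < n + N, y i = z i) ∧ (∀ i < n + N, w' i = w i) ∧ ∀ i ≥ n, w' i = y i := by
  set ε := (s' - s) / 4 with hε
  have hε0 : 0 < ε := by rw [hε]; linarith
  set G := E ∩ nbhdCyl z (n + N) with hG
  set H := Hsr G s' r with hH
  have hH0 : H ≠ 0 := hst.pos.ne'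
  have hH1 : H ≠ ⊤ :=
    ((Hsr_inter_nbhdCyl_le_one E z hs' hst.lt_level).trans_lt ENNReal.one_lt_top).ne
  obtain ⟨c, hc⟩ := exists_color_eventually (G := G) inter_subset_left hs' hB hκ hH0 hH1
  have hκH : 0 < κ * H := ENNReal.mul_pos hκ0 hH0
  have hcF := hcol c (hc.mono fun k hk =>
    (nonempty_of_Hsr_pos (hκH.trans_le hk)).mono (inter_subset_inter_left _ inter_subset_left))
  have hlarge : ∀ᶠ k : ℕ in atTop,
      ENNReal.ofReal (Real.exp (-(ε * k)) * Real.exp ((s' - s) / 2 * n)) < κ / 4 := by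
    have hlim : Tendsto (fun k : ℕ => ENNReal.ofReal
        (Real.exp (-(ε * k)) * Real.exp ((s' - s) / 2 * n))) atTop (nhds 0) := by
      have h1 : Tendsto (fun k : ℕ => Real.exp (-(ε * k))) atTop (nhds 0) :=
        Real.tendsto_exp_neg_atTop_nhds_zero.comp
          (tendsto_natCast_atTop_atTop.const_mul_atTop hε0)
      simpa using ENNReal.tendsto_ofReal (h1.mul_const (Real.exp ((s' - s) / 2 * n)))
    exact hlim.eventually_lt_const (ENNReal.div_pos hκ0 (by norm_num))
  obtain ⟨k, ⟨hck, z', hz'F, hz'⟩, hk1, hk2⟩ := ((hc.and hcF).and (Nat.hyperfilter_le_atTop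
    (hlarge.and (eventually_ge_atTop (m + n + r' + N + 1))))).exists
  set Bad₁ := {y | y ∈ nbhdCyl z (n + N) ∧
    ∃ v ∈ extWords S w (n + N), splice w y (n + N) ∈ v.cylSet} with hBad₁
  set Bad₂ := {y | y ∈ E ∩ nbhdCyl z (n + N) ∧ ENNReal.ofReal (Real.exp (ε * k)) *
    Hsr (E ∩ nbhdCyl y (k + N)) s' r < extWeight S s (splice w y (n + N)) (k + N)} with hBad₂
  have hb1 : Hsr Bad₁ s' r ≤ κ * H / 4 := by
    refine (Hsr_splice_mem_le S hss.le (n := n) (by omega) hst.lt_level w z).trans ?_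
    calc _ ≤ ENNReal.ofReal (Real.exp (-((s' - s) * n))) *
          (ENNReal.ofReal (Real.exp ((s' - s) / 2 * n)) * H) := by gcongr; exact hst.weight_le
      _ = ENNReal.ofReal (Real.exp (-((s' - s) / 2 * n))) * H := by
        rw [← mul_assoc, ← ENNReal.ofReal_mul (Real.exp_nonneg _), ← Real.exp_add]
        congr 3; ring
      _ ≤ κ / 4 * H := by gcongr
      _ = _ := by rw [ENNReal.mul_div_right_comm]
  have hb2 : Hsr Bad₂ s' r ≤ κ * H / 4 := by
    refine (Hsr_extWeight_gt_le E S s s' (ε * k) r (by omega) w z).trans ?_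
    calc _ ≤ ENNReal.ofReal (Real.exp (-(ε * k))) *
          (ENNReal.ofReal (Real.exp ((s' - s) / 2 * n)) * H) := by gcongr; exact hst.weight_le
      _ = ENNReal.ofReal (Real.exp (-(ε * k)) * Real.exp ((s' - s) / 2 * n)) * H := by
        rw [← mul_assoc, ← ENNReal.ofReal_mul (Real.exp_nonneg _)]
      _ ≤ κ / 4 * H := by gcongr
      _ = _ := by rw [ENNReal.mul_div_right_comm]
  obtain ⟨y, ⟨⟨hyE, hyz⟩, hyc⟩, hy1, hy2⟩ :
      ∃ y, y ∈ G ∩ colorClass E s' r N B ε k c ∧ y ∉ Bad₁ ∧ y ∉ Bad₂ := by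
    by_contra! hcon
    have hsub : G ∩ colorClass E s' r N B ε k c ⊆ Bad₁ ∪ Bad₂ := fun y hy =>
      or_iff_not_imp_left.2 (hcon y hy)
    have hle := hck.trans (((Hsr_mono hsub s' r).trans (Hsr_union_le _ _ _ _)).trans
      (add_le_add hb1 hb2))
    rw [ENNReal.quarter_add_quarter] at hle
    exact absurd hle (ENNReal.half_lt_self hκH.ne' (ENNReal.mul_ne_top hκ1 hH1)).not_ge
  have hw' : ∀ i ≥ n, splice w y (n + N) i = y i := by
    intro i hi
    by_cases hiN : i < n + N
    · have := hst.agree (i - n) (by omega)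
      rw [Nat.add_sub_cancel' hi] at this
      simp [splice, hiN, this, hyz i hiN]
    · simp [splice, hiN]
  have hwlt : ∀ i < n + N, splice w y (n + N) i = w i := fun i hi => by simp [splice, hi]
  have hcont : Hsr (E ∩ nbhdCyl y (k + N)) s' r ≤
      ENNReal.ofReal (Real.exp (ε * k)) * Hsr (F ∩ nbhdCyl z' (k + N)) s' r' := by
    refine hyc.2.2.trans ?_
    calc ENNReal.ofReal (Real.exp (-(ε * k * (c.2 : ℕ))))
        = ENNReal.ofReal (Real.exp (ε * k)) *
          ENNReal.ofReal (Real.exp (-(ε * k * ((c.2 : ℕ) + 1)))) := by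
          rw [← ENNReal.ofReal_mul (Real.exp_nonneg _), ← Real.exp_add]
          congr 2; ring
      _ ≤ _ := by gcongr; exact hz'.2.1
  refine ⟨k, by omega, y, hyE, splice w y (n + N), z', ⟨by omega, ?_, ?_, ?_, ?_⟩, hyz, hwlt, hw'⟩
  · intro i hi
    rw [hw' _ (by omega)]
    exact (hyc.1 ⟨i, hi⟩).trans (hz'.1 ⟨i, hi⟩).symm
  · exact (ENNReal.ofReal_pos.2 (Real.exp_pos _)).trans_le hz'.2.1
  · have h1 : extWeight S s (splice w y (n + N)) (k + N) ≤
        ENNReal.ofReal (Real.exp (ε * k)) * Hsr (E ∩ nbhdCyl y (k + N)) s' r :=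
      not_lt.1 fun h => hy2 ⟨⟨hyE, hyz⟩, h⟩
    refine h1.trans ((mul_le_mul_right hcont _).trans_eq ?_)
    rw [← mul_assoc, ← ENNReal.ofReal_mul (Real.exp_nonneg _), ← Real.exp_add]
    congr 3; rw [hε]; ring
  · intro v hvS hvlen hv
    rcases le_or_gt v.len (n + N) with hle | hgt
    · refine hst.notMem v hvS hle fun i => ?_
      rw [← hv i, hwlt _ (i.2.trans_le hle)]
    · refine hy1 ⟨hyz, v, ⟨hvS, hgt.le, fun i hi => ?_⟩, hv⟩
      rw [← hv i, hwlt _ hi]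

lemma exists_dependent_seq {X : Type*} {P : ℕ → X → Prop} {R : ℕ → X → X → Prop} {x₀ : X}
    (h₀ : P 0 x₀) (h : ∀ j x, P j x → ∃ x', P (j + 1) x' ∧ R j x x') :
    ∃ f : ℕ → X, f 0 = x₀ ∧ ∀ j, P j (f j) ∧ R j (f j) (f (j + 1)) := by
  have : ∀ j (x : {x // P j x}), ∃ x' : {x // P (j + 1) x}, R j x x' := fun j x => by
    obtain ⟨x', hP, hR⟩ := h j x x.2
    exact ⟨⟨x', hP⟩, hR⟩
  choose g hg using this
  let f : ∀ j, {x // P j x} := fun j => Nat.rec (motive := fun j => {x // P j x}) ⟨x₀, h₀⟩ g j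
  exact ⟨fun j => (f j).1, rfl, fun j => ⟨(f j).2, hg j (f j)⟩⟩

/-- `x` follows the point `y j` on the positions from `n j` up to `n (j + 1) + N`, and `y 0` on the
positions before `n 0`. -/
structure IsSplicing {α : Type*} (N : ℕ) (n : ℕ → ℕ) (y : ℕ → ℕ → α) (x : ℕ → α) : Prop where
  growth : ∀ j, 2 * n j + N ≤ n (j + 1)
  agree_zero : ∀ i < n 0, x i = y 0 i
  agree : ∀ j i, n j ≤ i → i < n (j + 1) + N → x i = y j i

/-- Sets of positive content sharing their recurrent colours can be spliced along points avoiding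
any cover of small weight by cylinders of high level. -/
lemma exists_splicing_notMem {α : Type*} [Fintype α] {E : ℕ → Set (ℕ → α)} {r : ℕ → ℕ}
    {s s' : ℝ} (hss : s < s') (hs' : 0 ≤ s') {N B : ℕ} (hN : 0 < N)
    (hB : (Fintype.card α : ℝ) * Real.exp (-((s' - s) / 4 * (B + 1))) ≤ 1 / 2)
    (hE : ∀ j, 0 < Hsr (E j) s' (r j))
    (hcol : ∀ j c,
      (∀ᶠ n in (hyperfilter ℕ : Filter ℕ),
        (E j ∩ colorClass (E j) s' (r j) N B ((s' - s) / 4) n c).Nonempty) →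
      (∀ᶠ n in (hyperfilter ℕ : Filter ℕ),
        (E (j + 1) ∩ colorClass (E (j + 1)) s' (r (j + 1)) N B ((s' - s) / 4) n c).Nonempty))
    (m : ℕ → ℕ) :
    ∃ (R : ℕ) (η : ℝ≥0∞), 0 < η ∧ ∀ S : Set (Word α), (∀ v ∈ S, R < v.len) →
      ∑' v : S, Word.weight s (v : Word α) < η →
      ∃ (n : ℕ → ℕ) (y : ℕ → ℕ → α) (x : ℕ → α), x ∉ ⋃ v ∈ S, v.cylSet ∧
        (∀ j, y j ∈ E j ∧ m j ≤ n j) ∧ IsSplicing N n y x := by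
  obtain ⟨κ, hκ0, hκ1, hκ⟩ : ∃ κ : ℝ≥0∞, κ ≠ 0 ∧ κ ≠ ⊤ ∧
      (Fintype.card ((Fin N → α) × Fin (B + 1)) : ℝ≥0∞) * κ ≤ 1 / 4 := by
    set M := Fintype.card ((Fin N → α) × Fin (B + 1))
    refine ⟨(1 / 4) / ((M : ℝ≥0∞) + 1), ?_, ?_, ?_⟩
    · exact (ENNReal.div_pos (by norm_num) (by finiteness)).ne'
    · exact ENNReal.div_ne_top (by norm_num) (by positivity)
    · rw [← mul_div_assoc]
      refine ENNReal.div_le_of_le_mul ?_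
      rw [mul_comm]
      gcongr
      exact le_self_add
  obtain ⟨N₀, hN₀⟩ : ∃ N₀ : ℕ, ∀ n ≥ N₀,
      ENNReal.ofReal (Real.exp (-((s' - s) / 2 * n))) ≤ κ / 4 := by
    have h1 : Tendsto (fun k : ℕ => Real.exp (-((s' - s) / 2 * k))) atTop (nhds 0) :=
      Real.tendsto_exp_neg_atTop_nhds_zero.comp
        (tendsto_natCast_atTop_atTop.const_mul_atTop (by linarith))
    have h2 := ENNReal.tendsto_ofReal h1
    rw [ENNReal.ofReal_zero] at h2
    obtain ⟨N₀, h⟩ := eventually_atTop.1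
      (h2.eventually_lt_const (ENNReal.div_pos hκ0 (by norm_num : (4 : ℝ≥0∞) ≠ ⊤)))
    exact ⟨N₀, fun n hn => (h n hn).le⟩
  set n₀ := max (max N₀ (m 0)) (r 0) with hn₀
  obtain ⟨z₀, -, hz₀⟩ := exists_Hsr_inter_nbhdCyl_pos (hE 0) (n₀ + N)
  refine ⟨n₀ + N, ENNReal.ofReal (Real.exp ((s' - s) / 2 * n₀)) *
    Hsr (E 0 ∩ nbhdCyl z₀ (n₀ + N)) s' (r 0),
    ENNReal.mul_pos (ENNReal.ofReal_pos.2 (Real.exp_pos _)).ne' hz₀.ne', fun S hS hSη => ?_⟩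
  let P : ℕ → ℕ × (ℕ → α) × (ℕ → α) → Prop := fun j t =>
    SpliceState S (E j) s s' (r j) N t.1 t.2.1 t.2.2 ∧ N₀ ≤ t.1 ∧ m j ≤ t.1
  let Q : ℕ → ℕ × (ℕ → α) × (ℕ → α) → ℕ × (ℕ → α) × (ℕ → α) → Prop := fun j t t' =>
    2 * t.1 + N ≤ t'.1 ∧ ∃ y ∈ E j, (∀ i < t.1 + N, y i = t.2.2 i) ∧
      (∀ i < t.1 + N, t'.2.1 i = t.2.1 i) ∧ ∀ i ≥ t.1, t'.2.1 i = y i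
  have h₀ : P 0 (n₀, z₀, z₀) := by
    refine ⟨⟨?_, fun _ _ => rfl, hz₀, ?_, ?_⟩, ?_, ?_⟩
    · change r 0 < n₀ + N; omega
    · refine (ENNReal.tsum_mono_subtype _ fun v hv => hv.1).trans hSη.le
    · exact fun v hv hle => absurd hle (hS v hv).not_ge
    · change N₀ ≤ n₀; omega
    · change m 0 ≤ n₀; omega
  have hstep : ∀ j t, P j t → ∃ t', P (j + 1) t' ∧ Q j t t' := by
    rintro j ⟨n, w, z⟩ ⟨hst, hn, -⟩
    obtain ⟨n', hn', y, hyE, w', z', hst', h1, h2, h3⟩ :=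
      hst.exists_next hss hs' hB hκ0 hκ1 hκ (hN₀ n hn) (hcol j)
        (max (max N₀ (m (j + 1))) (2 * n + N))
    exact ⟨(n', w', z'), ⟨hst', by dsimp only; omega, by dsimp only; omega⟩,
      by dsimp only; omega, y, hyE, h1, h2, h3⟩
  obtain ⟨f, hf0, hf⟩ := exists_dependent_seq h₀ hstep
  have hgrow : ∀ j, 2 * (f j).1 + N ≤ (f (j + 1)).1 := fun j => (hf j).2.1
  choose y hyE hyz hwlt hwge using fun j => (hf j).2.2
  have hmono : Monotone fun j => (f j).1 := monotone_nat_of_le_succ fun j => by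
    have := hgrow j
    omega
  have hwmono : ∀ j k, j ≤ k → ∀ i < (f j).1 + N, (f k).2.1 i = (f j).2.1 i := by
    intro j k hjk
    induction k, hjk using Nat.le_induction with
    | base => exact fun _ _ => rfl
    | succ k hjk ih =>
      intro i hi
      have : (f j).1 ≤ (f k).1 := hmono hjk
      rw [hwlt k i (by omega), ih i hi]
  have hid : ∀ j, j ≤ (f j).1 := by
    intro j
    induction j with
    | zero => omega
    | succ j ih => have := hgrow j; omega
  let x : ℕ → α := fun i => (f i).2.1 i
  have hx : ∀ j, ∀ i < (f j).1 + N, x i = (f j).2.1 i := by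
    intro j i hi
    have hi' : i < (f i).1 + N := by have := hid i; omega
    rw [← hwmono j (max i j) (le_max_right _ _) i hi]
    exact (hwmono i (max i j) (le_max_left _ _) i hi').symm
  refine ⟨fun j => (f j).1, y, x, ?_, fun j => ⟨hyE j, (hf j).1.2.2⟩, hgrow, ?_, ?_⟩
  · simp only [mem_iUnion, not_exists]
    intro v hv hxv
    have hlen : v.len ≤ (f v.len).1 + N := by have := hid v.len; omega
    refine (hf v.len).1.1.notMem v hv hlen fun i => ?_
    rw [← hx v.len i (i.2.trans_le hlen)]
    exact hxv i
  · intro i hi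
    rw [hx 0 i (by omega), hyz 0 i (by omega), hf0]
  · intro j i h1 h2
    rw [hx (j + 1) i h2, hwge j i h1]

/-! ### Birkhoff averages of spliced points -/

lemma iterate_shift_apply {α : Type*} (k : ℕ) (x : ℕ → α) (i : ℕ) :
    shift^[k] x i = x (k + i) := by
  induction k generalizing i with
  | zero => simp
  | succ k ih =>
    rw [Function.iterate_succ_apply', shift, ih]
    congr 1; omega

lemma iterate_shift_mem_SigmaA {K : ℕ} {M : Fin K → Fin K → Bool} {x : ℕ → Fin K}
    (hx : x ∈ SigmaA M) (k : ℕ) : shift^[k] x ∈ SigmaA M := fun i => by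
  simp only [iterate_shift_apply]
  exact hx (k + i)

/-- The (non-autonomous) Birkhoff sum `∑_{k<n} φ_k(σ^k x)`. -/
noncomputable def birkSum {α : Type*} (φ : ℕ → (ℕ → α) → ℝ) (n : ℕ) (x : ℕ → α) : ℝ :=
  ∑ k ∈ Finset.range n, φ k (shift^[k] x)

lemma tendsto_zero_of_le_half_add {a t : ℕ → ℝ} (ha : ∀ j, 0 ≤ a j)
    (ht : Tendsto t atTop (nhds 0)) (h : ∀ j, a (j + 1) ≤ a j / 2 + t j) :
    Tendsto a atTop (nhds 0) := by
  refine Metric.tendsto_atTop.2 fun δ hδ => ?_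
  obtain ⟨J, hJ⟩ := eventually_atTop.1 (ht.eventually_lt_const (show (0 : ℝ) < δ / 4 by linarith))
  have hrec : ∀ i, a (J + i) ≤ a J * (1 / 2) ^ i + δ / 2 := by
    intro i
    induction i with
    | zero => simp; linarith
    | succ i ih =>
      have h1 := h (J + i)
      have h2 := hJ (J + i) (by omega)
      rw [← add_assoc, pow_succ]
      linarith
  have hlim : Tendsto (fun i : ℕ => a J * (1 / 2 : ℝ) ^ i) atTop (nhds 0) := by
    simpa using (tendsto_pow_atTop_nhds_zero_of_lt_one (r := (1 / 2 : ℝ)) (by norm_num)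
      (by norm_num)).const_mul (a J)
  obtain ⟨I, hI⟩ := eventually_atTop.1
    (hlim.eventually_lt_const (show (0 : ℝ) < δ / 2 by linarith))
  refine ⟨J + I, fun n hn => ?_⟩
  obtain ⟨i, rfl⟩ := Nat.exists_eq_add_of_le (show J ≤ n by omega)
  rw [Real.dist_eq, sub_zero, abs_of_nonneg (ha _)]
  have := hrec i
  have := hI i (by omega)
  linarith

lemma exists_block {n : ℕ → ℕ} (hn : StrictMono n) {k : ℕ} (hk : n 0 ≤ k) :
    ∃ j, n j ≤ k ∧ k < n (j + 1) := by
  induction k, hk using Nat.le_induction with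
  | base => exact ⟨0, le_rfl, hn (by omega)⟩
  | succ k hk ih =>
    obtain ⟨j, h1, h2⟩ := ih
    rcases lt_or_ge (k + 1) (n (j + 1)) with h | h
    · exact ⟨j, by omega, h⟩
    · exact ⟨j + 1, h, by have := hn (show j + 1 < j + 1 + 1 by omega); omega⟩

lemma IsSplicing.strictMono {α : Type*} {N : ℕ} (hN : 0 < N) {n : ℕ → ℕ} {y : ℕ → ℕ → α}
    {x : ℕ → α} (h : IsSplicing N n y x) : StrictMono n :=
  strictMono_nat_of_lt_succ fun j => by have := h.growth j; omega

lemma IsSplicing.mem_SigmaA {K : ℕ} {M : Fin K → Fin K → Bool} {N : ℕ} (hN : 0 < N) {n : ℕ → ℕ}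
    {y : ℕ → ℕ → Fin K} {x : ℕ → Fin K} (h : IsSplicing N n y x)
    (hy : ∀ j, y j ∈ SigmaA M) : x ∈ SigmaA M := by
  have hzero : ∀ i < n 1 + N, x i = y 0 i := fun i hi => by
    by_cases h0 : i < n 0
    · exact h.agree_zero i h0
    · exact h.agree 0 i (by omega) hi
  intro k
  rcases lt_or_ge k (n 0) with hk | hk
  · have := h.strictMono hN (show 0 < 1 by omega)
    rw [hzero k (by omega), hzero (k + 1) (by omega)]
    exact hy 0 k
  · obtain ⟨j, h1, h2⟩ := exists_block (h.strictMono hN) hk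
    rw [h.agree j k h1 (by omega), h.agree j (k + 1) (by omega) (by omega)]
    exact hy j k

/-- Two points agreeing on `[a, b + N)` have close Birkhoff sums over `[a, k)` for `k ≤ b`, up to a
bounded contribution of the times close to `b`. -/
lemma abs_birkSum_sub_le {K : ℕ} {M : Fin K → Fin K → Bool} {φ : ℕ → (ℕ → Fin K) → ℝ}
    {N N' : ℕ} {δ : ℝ} (hδ : 0 ≤ δ)
    (hN : ∀ i, ∀ x ∈ SigmaA M, ∀ y ∈ SigmaA M, (∀ k < N, x k = y k) → |φ i x - φ i y| < 1)
    (hN' : ∀ i, ∀ x ∈ SigmaA M, ∀ y ∈ SigmaA M, (∀ k < N', x k = y k) → |φ i x - φ i y| < δ)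
    {x y : ℕ → Fin K} (hx : x ∈ SigmaA M) (hy : y ∈ SigmaA M) {a b k : ℕ} (hak : a ≤ k)
    (hkb : k ≤ b) (hxy : ∀ i, a ≤ i → i < b + N → x i = y i) :
    |(birkSum φ k x - birkSum φ a x) - (birkSum φ k y - birkSum φ a y)| ≤ δ * k + N' := by
  have hterm : ∀ i ∈ Finset.Ico a k, |φ i (shift^[i] x) - φ i (shift^[i] y)| ≤
      δ + if k ≤ i + N' then 1 else 0 := by
    intro i hi
    rw [Finset.mem_Ico] at hi
    split_ifs with h
    · have := hN i _ (iterate_shift_mem_SigmaA hx i) _ (iterate_shift_mem_SigmaA hy i)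
        fun l hl => by
          rw [iterate_shift_apply, iterate_shift_apply]
          exact hxy _ (by omega) (by omega)
      linarith
    · have := hN' i _ (iterate_shift_mem_SigmaA hx i) _ (iterate_shift_mem_SigmaA hy i)
        fun l hl => by
          rw [iterate_shift_apply, iterate_shift_apply]
          exact hxy _ (by omega) (by omega)
      linarith
  unfold birkSum
  rw [← Finset.sum_Ico_eq_sub _ hak, ← Finset.sum_Ico_eq_sub _ hak, ← Finset.sum_sub_distrib]
  refine (Finset.abs_sum_le_sum_abs _ _).trans ((Finset.sum_le_sum hterm).trans ?_)
  rw [Finset.sum_add_distrib, Finset.sum_const, Nat.card_Ico, nsmul_eq_mul, mul_comm,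
    Finset.sum_boole]
  have hcard : ((Finset.Ico a k).filter fun i => k ≤ i + N').card ≤ N' := by
    refine (Finset.card_le_card (t := Finset.Ico (k - N') k) fun i hi => ?_).trans ?_
    · simp only [Finset.mem_filter, Finset.mem_Ico] at hi ⊢
      omega
    · rw [Nat.card_Ico]; omega
  gcongr
  exact Nat.sub_le k a

lemma IsSplicing.tendsto_birk {K : ℕ} {M : Fin K → Fin K → Bool} {φ : ℕ → (ℕ → Fin K) → ℝ}
    (hUDV : UDV M φ) {N : ℕ} (hN0 : 0 < N)
    (hN : ∀ i, ∀ x ∈ SigmaA M, ∀ y ∈ SigmaA M, (∀ k < N, x k = y k) → |φ i x - φ i y| < 1)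
    {n : ℕ → ℕ} {y : ℕ → ℕ → Fin K} {x : ℕ → Fin K} (h : IsSplicing N n y x)
    (hy : ∀ j, y j ∈ SigmaA M) {α : ℝ} {e : ℕ → ℝ} (he : Tendsto e atTop (nhds 0))
    (hye : ∀ j, ∀ k ≥ n j, |birkSum φ k (y j) - k * α| ≤ e j * k) (hn0 : 0 < n 0) :
    Tendsto (fun k => birk φ k x) atTop (nhds α) := by
  have hx := h.mem_SigmaA hN0 hy
  have hmono := h.strictMono hN0
  have hnpos : ∀ j, (0 : ℝ) < n j := fun j => by
    exact_mod_cast hn0.trans_le (hmono.monotone (Nat.zero_le j))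
  have he0 : ∀ j, 0 ≤ e j := fun j =>
    nonneg_of_mul_nonneg_left ((abs_nonneg _).trans (hye j (n j) le_rfl)) (hnpos j)
  choose N' hN' using hUDV
  have hN'' : ∀ δ (hδ : 0 < δ), ∀ i, ∀ x ∈ SigmaA M, ∀ y ∈ SigmaA M,
      (∀ k < N' δ hδ, x k = y k) → |φ i x - φ i y| < δ := fun δ hδ => hN' δ hδ _ le_rfl
  -- the deviation of the Birkhoff sums from the expected values
  let D : ℕ → ℝ := fun k => |birkSum φ k x - k * α|
  have hD : ∀ δ (hδ : 0 < δ) j k, n j ≤ k → k ≤ n (j + 1) →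
      D k ≤ D (n j) + (2 * e j + δ) * k + N' δ hδ := by
    intro δ hδ j k h1 h2
    have hs := abs_birkSum_sub_le hδ.le hN (hN'' δ hδ) hx (hy j) h1 h2 (h.agree j)
    have hk := hye j k h1
    have hnj := hye j (n j) le_rfl
    have hnk : e j * n j ≤ e j * k := mul_le_mul_of_nonneg_left (by exact_mod_cast h1) (he0 j)
    simp only [D]
    rw [abs_le] at hs hk hnj ⊢
    have h3 := neg_abs_le (birkSum φ (n j) x - n j * α)
    have h4 := le_abs_self (birkSum φ (n j) x - n j * α)
    constructor <;> linarith
  have hquot : ∀ δ (hδ : 0 < δ) j k, n j ≤ k → k ≤ n (j + 1) →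
      D k / k ≤ D (n j) / k + (2 * e j + δ + N' δ hδ / n j) := by
    intro δ hδ j k h1 h2
    have hk0 : (0 : ℝ) < k := (hnpos j).trans_le (by exact_mod_cast h1)
    have h3 := div_le_div_of_nonneg_right (hD δ hδ j k h1 h2) hk0.le
    have h4 : (N' δ hδ : ℝ) / k ≤ N' δ hδ / n j :=
      div_le_div_of_nonneg_left (by positivity) (hnpos j) (by exact_mod_cast h1)
    rw [add_div, add_div, mul_div_cancel_right₀ _ hk0.ne'] at h3
    linarith
  have hD0 : ∀ k, 0 ≤ D k := fun k => abs_nonneg _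
  have hntop : Tendsto (fun j => (n j : ℝ)) atTop atTop :=
    tendsto_natCast_atTop_atTop.comp hmono.tendsto_atTop
  have herr : ∀ δ (hδ : 0 < δ), ∀ᶠ j in atTop, 2 * e j + δ + N' δ hδ / n j < 2 * δ := by
    intro δ hδ
    have h1 : Tendsto (fun j => 2 * e j + δ + N' δ hδ / n j) atTop (nhds (2 * 0 + δ + 0)) :=
      ((he.const_mul 2).add_const δ).add (hntop.const_div_atTop _)
    exact h1.eventually_lt_const (by linarith)
  have ha : Tendsto (fun j => D (n j) / n j) atTop (nhds 0) := by
    let t : ℕ → ℝ := fun j => max 0 (D (n (j + 1)) / n (j + 1) - D (n j) / n j / 2)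
    refine tendsto_zero_of_le_half_add (t := t) (fun j => div_nonneg (hD0 _) (hnpos j).le) ?_
      fun j => ?_
    · refine Metric.tendsto_nhds.2 fun δ hδ => ?_
      filter_upwards [herr (δ / 2) (by linarith)] with j hj
      have h1 := hquot (δ / 2) (by linarith) j (n (j + 1)) (hmono (by omega)).le le_rfl
      have h2 : D (n j) / n (j + 1) ≤ D (n j) / n j / 2 := by
        rw [div_div]
        refine div_le_div_of_nonneg_left (hD0 _) (by linarith [hnpos j]) ?_
        have := h.growth j
        exact_mod_cast (show n j * 2 ≤ n (j + 1) by omega)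
      rw [Real.dist_eq, sub_zero, abs_of_nonneg (le_max_left _ _)]
      exact max_lt hδ (by linarith)
    · have := le_max_right 0 (D (n (j + 1)) / n (j + 1) - D (n j) / n j / 2)
      simp only [t]
      linarith
  refine Metric.tendsto_atTop.2 fun δ hδ => ?_
  obtain ⟨J, hJ⟩ := eventually_atTop.1 ((herr (δ / 4) (by linarith)).and
    (ha.eventually_lt_const (show (0 : ℝ) < δ / 2 by linarith)))
  refine ⟨n J, fun k hk => ?_⟩
  obtain ⟨j, h1, h2⟩ := exists_block hmono ((hmono.monotone (Nat.zero_le J)).trans hk)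
  have hJj : J ≤ j := by
    by_contra! hlt
    have := hmono.monotone (show j + 1 ≤ J by omega)
    omega
  obtain ⟨h3, h4⟩ := hJ j hJj
  have hk0 : (0 : ℝ) < k := (hnpos j).trans_le (by exact_mod_cast h1)
  have h5 := hquot (δ / 4) (by linarith) j k h1 h2.le
  have h6 : D (n j) / k ≤ D (n j) / n j :=
    div_le_div_of_nonneg_left (hD0 _) (hnpos j) (by exact_mod_cast h1)
  have h7 : dist (birk φ k x) α = D k / k := by
    rw [Real.dist_eq]
    simp only [D]
    rw [← abs_of_pos hk0, ← abs_div, abs_of_pos hk0, sub_div, mul_div_cancel_left₀ _ hk0.ne']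
    rfl
  rw [h7]
  linarith

/-! ### Positivity of the contents of level sets -/

lemma exists_Hsr_pos_of_Hentm_pos {K : ℕ} {M : Fin K → Fin K → Bool}
    {φ : ℕ → (ℕ → Fin K) → ℝ} {β s : ℝ} (h : 0 < Hentm (LAlim M φ β) s) {ε : ℝ} (hε : 0 < ε) :
    ∃ r m : ℕ, 0 < Hsr {y | y ∈ SigmaA M ∧ ∀ n ≥ m, |birkSum φ n y - n * β| ≤ ε * n} s r := by
  obtain ⟨r, hr⟩ := lt_iSup_iff.1 h
  refine ⟨r, ?_⟩
  by_contra! hm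
  refine hr.not_ge ?_
  refine (Hsr_mono (F := ⋃ m : ℕ,
    {y | y ∈ SigmaA M ∧ ∀ n ≥ m, |birkSum φ n y - n * β| ≤ ε * n}) ?_ s r).trans ?_
  · rintro y ⟨hy, hlim⟩
    obtain ⟨m, hm⟩ := Metric.tendsto_atTop.1 hlim ε hε
    refine mem_iUnion.2 ⟨m + 1, hy, fun n hn => ?_⟩
    have hn0 : (0 : ℝ) < n := by exact_mod_cast (show 0 < n by omega)
    have h1 : birkSum φ n y - n * β = (birk φ n y - β) * n := by
      rw [sub_mul, birk, div_mul_cancel₀ _ hn0.ne', mul_comm β]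
      rfl
    have h2 := hm n (by omega)
    rw [Real.dist_eq] at h2
    rw [h1, abs_mul, abs_of_pos hn0]
    gcongr
  · refine (Hsr_iUnion_le _ s r).trans ?_
    simp [nonpos_iff_eq_zero.1 (hm _)]

lemma exists_strictMono_const {C : Type*} [Finite C] (c : ℕ → C) :
    ∃ ψ : ℕ → ℕ, StrictMono ψ ∧ ∀ i j, c (ψ i) = c (ψ j) := by
  obtain ⟨b, hb⟩ := Finite.exists_infinite_fiber c
  obtain ⟨ψ, hψ, h⟩ := extraction_of_frequently_atTop
    (Nat.frequently_atTop_iff_infinite.2 (infinite_coe_iff.1 hb))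
  exact ⟨ψ, hψ, fun i j => (h i).trans (h j).symm⟩

lemma Hentm_LAlim_pos {K : ℕ} {M : Fin K → Fin K → Bool} {φ : ℕ → (ℕ → Fin K) → ℝ}
    (hUDV : UDV M φ) {α s s' : ℝ} (hss : s < s') (hs' : 0 ≤ s')
    (h : ∃ᶠ β in nhds α, 0 < Hentm (LAlim M φ β) s') : 0 < Hentm (LAlim M φ α) s := by
  have hε : ∀ k : ℕ, (0 : ℝ) < 1 / ((k : ℝ) + 1) := fun k => Nat.one_div_pos_of_nat
  have hk : ∀ k : ℕ, ∃ r m : ℕ, 0 < Hsr {y | y ∈ SigmaA M ∧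
      ∀ n ≥ m, |birkSum φ n y - n * α| ≤ 2 * (1 / ((k : ℝ) + 1)) * n} s' r := by
    intro k
    obtain ⟨β, hβ, hβα⟩ := (h.and_eventually (Metric.ball_mem_nhds α (hε k))).exists
    obtain ⟨r, m, hrm⟩ := exists_Hsr_pos_of_Hentm_pos hβ (hε k)
    refine ⟨r, m, hrm.trans_le (Hsr_mono ?_ _ _)⟩
    rintro y ⟨hy, hyn⟩
    refine ⟨hy, fun n hn => ?_⟩
    have h1 : birkSum φ n y - n * α = (birkSum φ n y - n * β) + n * (β - α) := by ring
    have h2 : |(n : ℝ) * (β - α)| ≤ 1 / ((k : ℝ) + 1) * n := by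
      rw [abs_mul, Nat.abs_cast, mul_comm]
      gcongr
      exact (mem_ball_iff_norm.1 hβα).le
    rw [h1]
    refine (abs_add_le _ _).trans ?_
    linarith [hyn n hn]
  choose r m hpos using hk
  set E : ℕ → Set (ℕ → Fin K) := fun k => {y | y ∈ SigmaA M ∧
    ∀ n ≥ m k, |birkSum φ n y - n * α| ≤ 2 * (1 / ((k : ℝ) + 1)) * n} with hE
  obtain ⟨N₁, hN₁⟩ := hUDV 1 one_pos
  obtain ⟨B, hB⟩ : ∃ B : ℕ,
      (Fintype.card (Fin K) : ℝ) * Real.exp (-((s' - s) / 4 * (B + 1))) ≤ 1 / 2 := by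
    have h1 : Tendsto (fun B : ℕ => (s' - s) / 4 * ((B : ℝ) + 1)) atTop atTop :=
      (tendsto_atTop_add_const_right _ _ tendsto_natCast_atTop_atTop).const_mul_atTop
        (by linarith)
    have h2 := (Real.tendsto_exp_neg_atTop_nhds_zero.comp h1).const_mul (Fintype.card (Fin K) : ℝ)
    rw [mul_zero] at h2
    obtain ⟨B, hB⟩ := (h2.eventually_lt_const (show (0 : ℝ) < 1 / 2 by norm_num)).exists
    exact ⟨B, hB.le⟩
  obtain ⟨ψ, hψ, hcol⟩ := exists_strictMono_const
    fun k => {c : (Fin (N₁ + 1) → Fin K) × Fin (B + 1) | ∀ᶠ n in (hyperfilter ℕ : Filter ℕ),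
      (E k ∩ colorClass (E k) s' (r k) (N₁ + 1) B ((s' - s) / 4) n c).Nonempty}
  obtain ⟨R, η, hη, hR⟩ := exists_splicing_notMem (E := fun j => E (ψ j)) (r := fun j => r (ψ j))
    hss hs' (Nat.succ_pos N₁) hB (fun j => hpos (ψ j))
    (fun j c hc => (Set.ext_iff.1 (hcol j (j + 1)) c).1 hc) (fun j => m (ψ j) + 1)
  refine (hη.trans_le ?_).trans_le (le_iSup _ R)
  by_contra! hlt
  obtain ⟨S, hS, hcov, hsum⟩ := exists_cover_of_Hsr_lt hlt
  obtain ⟨n, y, x, hxS, hy, hsp⟩ := hR S hS hsum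
  have hyA : ∀ j, y j ∈ SigmaA M := fun j => (hy j).1.1
  refine hxS (hcov ⟨hsp.mem_SigmaA (Nat.succ_pos N₁) hyA, ?_⟩)
  refine hsp.tendsto_birk hUDV (Nat.succ_pos N₁) (hN₁ _ (Nat.le_succ N₁)) hyA
    (e := fun j => 2 * (1 / ((ψ j : ℝ) + 1))) ?_ ?_ ?_
  · simpa using (tendsto_one_div_add_atTop_nhds_zero_nat (𝕜 := ℝ)).comp hψ.tendsto_atTop
      |>.const_mul 2
  · intro j k hk
    exact (hy j).1.2 k (by have := (hy j).2; omega)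
  · have := (hy 0).2
    omega

/-! ### Topological entropy and the contents `Hentm` -/

lemma Hsr_mono_level {α : Type*} (E : Set (ℕ → α)) (s : ℝ) {r R : ℕ} (h : r ≤ R) :
    Hsr E s r ≤ Hsr E s R :=
  le_iInf fun S => le_iInf fun hS => le_iInf fun hE =>
    Hsr_le_tsum_subtype s S (fun w hw => h.trans_lt (hS w hw)) hE

lemma Hentm_empty {α : Type*} (s : ℝ) : Hentm (∅ : Set (ℕ → α)) s = 0 := by
  simp [Hentm]

lemma Hentm_zero_pos {α : Type*} {E : Set (ℕ → α)} (h : E.Nonempty) : 0 < Hentm E 0 := by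
  refine lt_of_lt_of_le zero_lt_one (le_iSup_of_le 0 ?_)
  refine le_iInf fun S => le_iInf fun _ => le_iInf fun hE => ?_
  obtain ⟨x, hx⟩ := h
  obtain ⟨w, hw, -⟩ := mem_iUnion₂.1 (hE hx)
  refine le_trans ?_ (ENNReal.le_tsum (⟨w, hw⟩ : S))
  simp

lemma Hsr_le_exp_mul {α : Type*} (E : Set (ℕ → α)) {s₀ s : ℝ} (h : s₀ ≤ s) (R : ℕ) :
    Hsr E s R ≤ ENNReal.ofReal (Real.exp (-((s - s₀) * R))) * Hsr E s₀ R := by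
  rcases eq_or_ne (Hsr E s₀ R) ⊤ with htop | htop
  · rw [htop, ENNReal.mul_top (ENNReal.ofReal_pos.2 (Real.exp_pos _)).ne']
    exact le_top
  refine ENNReal.le_of_forall_pos_le_add fun ε hε _ => ?_
  set a := ENNReal.ofReal (Real.exp (-((s - s₀) * R))) with ha
  have ha1 : a ≤ 1 := by
    rw [ha, ENNReal.ofReal_le_one, Real.exp_le_one_iff, neg_nonpos]
    exact mul_nonneg (by linarith) (Nat.cast_nonneg R)
  obtain ⟨S, hS, hE, hlt⟩ := exists_cover_of_Hsr_lt
    (ENNReal.lt_add_right htop (ENNReal.coe_pos.2 hε).ne')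
  calc Hsr E s R ≤ ∑' w : S, Word.weight s (w : Word α) := Hsr_le_tsum_subtype s S hS hE
    _ ≤ ∑' w : S, a * Word.weight s₀ (w : Word α) := by
        refine ENNReal.tsum_le_tsum fun w => ?_
        rw [ha, Word.weight, Word.weight, ← ENNReal.ofReal_mul (Real.exp_nonneg _), ← Real.exp_add]
        refine ENNReal.ofReal_le_ofReal (Real.exp_le_exp.2 ?_)
        have h1 : (R : ℝ) ≤ ((w : Word α).len : ℝ) := by exact_mod_cast (hS w w.2).le
        nlinarith
    _ = a * ∑' w : S, Word.weight s₀ (w : Word α) := ENNReal.tsum_mul_left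
    _ ≤ a * (Hsr E s₀ R + ε) := by gcongr
    _ = a * Hsr E s₀ R + a * ε := mul_add _ _ _
    _ ≤ a * Hsr E s₀ R + ε := by
        gcongr
        exact mul_le_of_le_one_left zero_le ha1

lemma Hentm_eq_zero {α : Type*} {E : Set (ℕ → α)} {s₀ s : ℝ} (h : s₀ < s)
    (hE : Hentm E s₀ ≠ ⊤) : Hentm E s = 0 := by
  refine nonpos_iff_eq_zero.1 (iSup_le fun r => ?_)
  have h1 : Tendsto (fun R : ℕ => (s - s₀) * (R : ℝ)) atTop atTop :=
    tendsto_natCast_atTop_atTop.const_mul_atTop (by linarith)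
  have h2 : Tendsto (fun R : ℕ => ENNReal.ofReal (Real.exp (-((s - s₀) * R))) * Hentm E s₀)
      atTop (nhds (ENNReal.ofReal 0 * Hentm E s₀)) :=
    ENNReal.Tendsto.mul_const
      (ENNReal.tendsto_ofReal (Real.tendsto_exp_neg_atTop_nhds_zero.comp h1)) (Or.inr hE)
  rw [ENNReal.ofReal_zero, zero_mul] at h2
  refine ge_of_tendsto h2 (eventually_atTop.2 ⟨r, fun R hR => ?_⟩)
  refine (Hsr_mono_level E s hR).trans ((Hsr_le_exp_mul E h.le R).trans ?_)
  gcongr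
  exact le_iSup (Hsr E s₀) R

lemma Hentm_card_le_one {α : Type*} [Fintype α] (E : Set (ℕ → α)) :
    Hentm E (Fintype.card α) ≤ 1 := by
  refine iSup_le fun r => ?_
  refine (Hsr_le_tsum (ι := Fin (r + 1) → α) _ (fun u => ⟨r + 1, u⟩) (fun _ => Nat.lt_succ_self r)
    fun x _ => mem_iUnion.2 ⟨fun i => x i, fun _ => rfl⟩).trans ?_
  classical
  have hw : ∀ u : Fin (r + 1) → α, Word.weight (Fintype.card α) (⟨r + 1, u⟩ : Word α) =
      ENNReal.ofReal (Real.exp (-(Fintype.card α : ℝ))) ^ (r + 1) := fun u => by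
    rw [← ENNReal.ofReal_pow (Real.exp_nonneg _), ← Real.exp_nat_mul, mul_comm]
    rfl
  rw [tsum_fintype, Finset.sum_congr rfl fun u _ => hw u, Finset.sum_const, Finset.card_univ,
    Fintype.card_fun, Fintype.card_fin, nsmul_eq_mul, Nat.cast_pow, ← mul_pow]
  refine pow_le_one₀ zero_le ?_
  rw [← ENNReal.ofReal_natCast, ← ENNReal.ofReal_mul (Nat.cast_nonneg _), ENNReal.ofReal_le_one,
    Real.exp_neg, ← div_eq_mul_inv, div_le_one (Real.exp_pos _)]
  linarith [Real.add_one_le_exp (Fintype.card α : ℝ)]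

lemma exists_Hentm_ne_top_of_htop_lt {α : Type*} [Fintype α] {E : Set (ℕ → α)} {t : ℝ}
    (hE : E.Nonempty) (h : htop E < t) : ∃ s₀ < t, Hentm E s₀ ≠ ⊤ := by
  rw [htop, if_neg hE.ne_empty, EReal.coe_lt_coe_iff] at h
  have hne : {s : ℝ | 0 ≤ s ∧ Hentm E s ≠ ⊤}.Nonempty := ⟨(Fintype.card α : ℝ), Nat.cast_nonneg _,
    ((Hentm_card_le_one E).trans_lt ENNReal.one_lt_top).ne⟩
  obtain ⟨s₀, hs₀, hlt⟩ := exists_lt_of_csInf_lt hne h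
  exact ⟨s₀, hlt, hs₀.2⟩

lemma htop_le_of_Hentm_ne_top {α : Type*} {E : Set (ℕ → α)} {t : ℝ} (ht : 0 ≤ t)
    (h : Hentm E t ≠ ⊤) : htop E ≤ t := by
  rw [htop]
  split_ifs
  · exact bot_le
  · exact EReal.coe_le_coe_iff.2 (csInf_le ⟨0, fun _ hs => hs.1⟩ ⟨ht, h⟩)

lemma htop_nonneg {α : Type*} {E : Set (ℕ → α)} (hE : E.Nonempty) : 0 ≤ htop E := by
  rw [htop, if_neg hE.ne_empty]
  exact EReal.coe_nonneg.2 (Real.sInf_nonneg fun _ hs => hs.1)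

theorem spectrum_upper_semicontinuous
    {K : ℕ} (M : Fin K → Fin K → Bool) (hA : ApIrr M)
    (φ : ℕ → (ℕ → Fin K) → ℝ)
    (hcont : ∀ i : ℕ, ContinuousOn (φ i) (SigmaA M))
    (hUDV : UDV M φ) :
    UpperSemicontinuous (fun α : ℝ => htop (LAlim M φ α)) := by
  intro α y hy
  by_contra hcon
  have hfreq : ∃ᶠ β in nhds α, y ≤ htop (LAlim M φ β) := by
    simpa only [Filter.not_eventually, not_lt] using hcon
  rcases (LAlim M φ α).eq_empty_or_nonempty with hα | hα
  · have hpos := Hentm_LAlim_pos hUDV (s := -1) (s' := 0) (by norm_num) le_rfl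
      (hfreq.mono fun β hβ => Hentm_zero_pos ?_)
    · rw [hα, Hentm_empty] at hpos
      exact hpos.false
    · by_contra! hemp
      rw [htop, if_pos hemp] at hβ
      exact (bot_le.trans_lt hy).not_ge hβ
  · obtain ⟨t, ht, hty⟩ := EReal.lt_iff_exists_real_btwn.1 hy
    obtain ⟨s₀, hs₀, hfin⟩ := exists_Hentm_ne_top_of_htop_lt hα ht
    have ht0 : 0 ≤ t := EReal.coe_nonneg.1 ((htop_nonneg hα).trans ht.le)
    have hpos := Hentm_LAlim_pos hUDV (s := (s₀ + t) / 2) (s' := t) (by linarith) ht0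
      (hfreq.mono fun β hβ => by
        by_contra! h0
        refine (hty.trans_le hβ).not_ge (htop_le_of_Hentm_ne_top ht0 ?_)
        exact (h0.trans_lt ENNReal.zero_lt_top).ne)
    rw [Hentm_eq_zero (show s₀ < (s₀ + t) / 2 by linarith) hfin] at hpos
    exact hpos.false
end

section
/- Let Σ_A ⊆ Σ be an aperiodic and irreducible subshift of finite type, let ν be a σ-invariant ergodic quasi-Bernoulli measure on Ω, and let f, g : Γ_A → ℝ be continuous potentials with bounded variation. Then the function p : t ↦ P_ν((1−t)g + tf) is differentiable at t = 0, and p′(0) = ∫ (f − g) dμ_g, where μ_g is the unique ergodic conditional equilibrium measure of g, i.e. the unique ergodic σ-invariant measure on Γ_A comparable up to uniform multiplicative constants to (Y(g,𝐰,𝐢)/W(g,𝐰))·ν([𝐰]) on every product cylinder [𝐰]×[𝐢] with |𝐰| = |𝐢|. -/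
open Filter Set
open scoped ENNReal

open MeasureTheory

/-- The product space `Γ = Ω × Σ`. -/
abbrev GaSp (N K : ℕ) := (ℕ → Fin N) × (ℕ → Fin K)

/-- The simultaneous left shift on `Γ`. -/
def shift2 {N K : ℕ} (p : GaSp N K) : GaSp N K := (shift p.1, shift p.2)

/-- Cylinder in `Γ` given by a pair of words of equal length. -/
def cylP {N K : ℕ} {n : ℕ} (w : Fin n → Fin N) (v : Fin n → Fin K) : Set (GaSp N K) :=
  {p | (∀ k : Fin n, p.1 (k : ℕ) = w k) ∧ (∀ k : Fin n, p.2 (k : ℕ) = v k)}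

/-- Cylinder determined by a `List` word (used for concatenations). -/
def cylL {α : Type*} (w : List α) : Set (ℕ → α) :=
  {x | ∀ (k : ℕ) (h : k < w.length), x k = w.get ⟨k, h⟩}

/-- `ν` is quasi-Bernoulli. -/
def QuasiBernoulli {N : ℕ} (ν : Measure (ℕ → Fin N)) : Prop :=
  ∃ C : ℝ≥0∞, 0 < C ∧ C ≠ ⊤ ∧ ∀ w z : List (Fin N),
    C⁻¹ * (ν (cylL w) * ν (cylL z)) ≤ ν (cylL (w ++ z)) ∧
    ν (cylL (w ++ z)) ≤ C * (ν (cylL w) * ν (cylL z))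

/-- Birkhoff sums `S_n g` on `Γ`. -/
noncomputable def SnS {N K : ℕ} (g : GaSp N K → ℝ) (n : ℕ) (p : GaSp N K) : ℝ :=
  ∑ k ∈ Finset.range n, g (shift2^[k] p)

/-- The fiberwise partition function
`Z_n(g,𝐰) = Σ_{𝐢∈Σ_{A,n}} sup_{𝐣∈[𝐢]} e^{S_n g(𝐰,𝐣)}`
(words with no admissible extension contribute `sSup ∅ = 0`). -/
noncomputable def Zn {N K : ℕ} (M : Fin K → Fin K → Bool) (g : GaSp N K → ℝ)
    (w : ℕ → Fin N) (n : ℕ) : ℝ :=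
  ∑ v : Fin n → Fin K,
    sSup ((fun j => Real.exp (SnS g n (w, j))) ''
      {j | j ∈ SigmaA M ∧ ∀ k : Fin n, j (k : ℕ) = v k})

/-- The conditional pressure `P_ν(g) = lim (1/n) ∫ log Z_n(g,𝐰) dν(𝐰)`
(realized as a `limsup`; the limit exists in the situations considered). -/
noncomputable def condPressure {N K : ℕ} (M : Fin K → Fin K → Bool)
    (ν : Measure (ℕ → Fin N)) (g : GaSp N K → ℝ) : ℝ :=
  Filter.limsup (fun n : ℕ => (∫ w, Real.log (Zn M g w n) ∂ν) / n) Filter.atTop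

/-- `g : Γ_A → E` has bounded variation:
`Σ_k max_{(𝐰,𝐢)∧(𝐳,𝐣) = k} ‖g(𝐰,𝐢) − g(𝐳,𝐣)‖ < ∞`. -/
def BddVar {N K : ℕ} {E : Type*} [NormedAddCommGroup E] (M : Fin K → Fin K → Bool)
    (g : GaSp N K → E) : Prop :=
  ∃ B : ℝ, ∀ m : ℕ,
    ∑ k ∈ Finset.range m,
      sSup {d : ℝ | ∃ p q : GaSp N K, p.2 ∈ SigmaA M ∧ q.2 ∈ SigmaA M ∧
        (∀ t < k, p.1 t = q.1 t) ∧ (∀ t < k, p.2 t = q.2 t) ∧ d = ‖g p - g q‖} ≤ B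

/-- `-x log x` (with the convention `0 · log 0 = 0`). -/
noncomputable def nlog (x : ℝ) : ℝ := -(x * Real.log x)

/-- The Kolmogorov–Sinai entropy of a shift-invariant measure on `Ω`,
computed through cylinders (realized as a `limsup`; the limit exists by
subadditivity). -/
noncomputable def entOm {N : ℕ} (ν : Measure (ℕ → Fin N)) : ℝ :=
  Filter.limsup
    (fun n : ℕ => (∑ w : Fin n → Fin N, nlog ((ν (cyl w)).toReal)) / n) Filter.atTop

/-- The Kolmogorov–Sinai entropy of a shift-invariant measure on `Γ`,
computed through cylinders. -/
noncomputable def entGa {N K : ℕ} (μ : Measure (GaSp N K)) : ℝ :=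
  Filter.limsup
    (fun n : ℕ =>
      (∑ w : Fin n → Fin N, ∑ v : Fin n → Fin K, nlog ((μ (cylP w v)).toReal)) / n)
    Filter.atTop

/-- `μ ∈ M_ν(Γ_A)`: a shift-invariant probability measure on `Γ_A` with
marginal `ν`. -/
def MemMnu {N K : ℕ} (M : Fin K → Fin K → Bool) (ν : Measure (ℕ → Fin N))
    (μ : Measure (GaSp N K)) : Prop :=
  IsProbabilityMeasure μ ∧ MeasurePreserving shift2 μ μ ∧
    μ.map Prod.fst = ν ∧ μ {p | p.2 ∈ SigmaA M} = 1

/-- `Y(g,𝐰,𝐢) = sup_{𝐳∈[𝐰]} sup_{𝐣∈[𝐢]∩Σ_A} e^{S_n g(𝐳,𝐣)}`. -/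
noncomputable def Yfun {N K : ℕ} (M : Fin K → Fin K → Bool) (g : GaSp N K → ℝ)
    {n : ℕ} (w : Fin n → Fin N) (v : Fin n → Fin K) : ℝ :=
  sSup ((fun p : GaSp N K => Real.exp (SnS g n p)) ''
    {p | (∀ k : Fin n, p.1 (k : ℕ) = w k) ∧ p.2 ∈ SigmaA M ∧
      ∀ k : Fin n, p.2 (k : ℕ) = v k})

/-- `W(g,𝐰) = sup_{𝐳∈[𝐰]} Z_{|𝐰|}(g,𝐳)`. -/
noncomputable def Wfun {N K : ℕ} (M : Fin K → Fin K → Bool) (g : GaSp N K → ℝ)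
    {n : ℕ} (w : Fin n → Fin N) : ℝ :=
  sSup ((fun z => Zn M g z n) '' {z : ℕ → Fin N | ∀ k : Fin n, z (k : ℕ) = w k})

/-- A word is admissible if it extends to a point of `Σ_A`. -/
def AdmissibleWord {K : ℕ} (M : Fin K → Fin K → Bool) {n : ℕ} (v : Fin n → Fin K) : Prop :=
  ∃ j ∈ SigmaA M, ∀ k : Fin n, j (k : ℕ) = v k

/-- `μ` is comparable, up to uniform multiplicative constants, to
`(Y(g,𝐰,𝐢)/W(g,𝐰))·ν([𝐰])` on product cylinders over admissible pairs. -/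
def EquilibriumProp {N K : ℕ} (M : Fin K → Fin K → Bool) (ν : Measure (ℕ → Fin N))
    (g : GaSp N K → ℝ) (μ : Measure (GaSp N K)) : Prop :=
  ∃ C : ℝ, 0 < C ∧ ∀ (n : ℕ) (w : Fin n → Fin N) (v : Fin n → Fin K),
    AdmissibleWord M v →
      ENNReal.ofReal (C⁻¹ * (Yfun M g w v / Wfun M g w) * (ν (cyl w)).toReal)
          ≤ μ (cylP w v) ∧
      μ (cylP w v)
          ≤ ENNReal.ofReal (C * (Yfun M g w v / Wfun M g w) * (ν (cyl w)).toReal)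


/-- The **mean ergodic theorem** in `L²` for an ergodic probability-preserving map. -/
theorem Ergodic.tendsto_integral_sq_average_sub {X : Type*} [MeasurableSpace X] {μ : Measure X}
    [IsProbabilityMeasure μ] {T : X → X} (hT : Ergodic T μ) {φ : X → ℝ} (hφ : MemLp φ 2 μ) :
    Tendsto (fun n : ℕ => ∫ x, ((∑ k ∈ Finset.range n, φ (T^[k] x)) / n - ∫ y, φ y ∂μ) ^ 2 ∂μ)
      atTop (nhds 0) := by
  set α : ℝ := ∫ y, φ y ∂μ with hα
  have hψ : MemLp (fun x => φ x - α) 2 μ := hφ.sub (memLp_const α)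
  set U : Lp ℝ 2 μ →L[ℝ] Lp ℝ 2 μ :=
    (Lp.compMeasurePreservingₗᵢ ℝ T hT.toMeasurePreserving).toContinuousLinearMap with hU
  have hUapp : ∀ h : Lp ℝ 2 μ, U h = Lp.compMeasurePreserving T hT.toMeasurePreserving h :=
    fun h => rfl
  have hUnorm : ‖U‖ ≤ 1 := LinearIsometry.norm_toContinuousLinearMap_le _
  set ψ : Lp ℝ 2 μ := hψ.toLp _ with hψdef
  have hlim := U.tendsto_birkhoffAverage_orthogonalProjection hUnorm ψ
  set F := (U.eqLocus (1 : Lp ℝ 2 μ →L[ℝ] Lp ℝ 2 μ)) with hF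
  set one : Lp ℝ 2 μ := (memLp_const (1 : ℝ)).toLp (fun _ : X => (1 : ℝ)) with hone
  have hone_mem : one ∈ F := by
    change U one = one
    rw [hUapp, hone, Lp.toLp_compMeasurePreserving]
    rfl
  have hproj : (F.orthogonalProjectionOnto ψ : Lp ℝ 2 μ) = 0 := by
    have hmem : U (F.orthogonalProjectionOnto ψ : Lp ℝ 2 μ) = F.orthogonalProjectionOnto ψ :=
      (F.orthogonalProjectionOnto ψ).2
    set q : Lp ℝ 2 μ := (F.orthogonalProjectionOnto ψ : Lp ℝ 2 μ) with hq
    have hcomp : (q : X → ℝ) ∘ T =ᵐ[μ] q := by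
      rw [hUapp] at hmem
      have := Lp.coeFn_compMeasurePreserving q hT.toMeasurePreserving
      rw [hmem] at this
      exact this.symm
    obtain ⟨c, hc⟩ := hT.ae_eq_const_of_ae_eq_comp_ae (Lp.aestronglyMeasurable q) hcomp
    have horth : inner ℝ one (ψ - q) = 0 :=
      (Submodule.mem_orthogonal _ _).1 (F.sub_starProjection_mem_orthogonal ψ) one hone_mem
    have h1 : inner ℝ one ψ = 0 := by
      rw [L2.inner_def]
      have : (fun a => inner ℝ (one a) (ψ a)) =ᵐ[μ] fun a => φ a - α := by
        filter_upwards [(memLp_const (1 : ℝ)).coeFn_toLp (p := 2) (μ := μ), hψ.coeFn_toLp]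
          with a h1 h2
        rw [hone, hψdef, h1, h2]
        simp
      rw [integral_congr_ae this, integral_sub (hφ.integrable (by norm_num)) (integrable_const _)]
      simp [hα]
    have h2 : inner ℝ one q = c := by
      rw [L2.inner_def]
      have : (fun a => inner ℝ (one a) (q a)) =ᵐ[μ] fun _ => c := by
        filter_upwards [(memLp_const (1 : ℝ)).coeFn_toLp (p := 2) (μ := μ), hc]
          with a h1 h2
        rw [hone, h1, h2]
        simp
      rw [integral_congr_ae this]
      simp
    rw [inner_sub_right, h1, h2] at horth
    have hc0 : c = 0 := by linarith
    rw [Lp.eq_zero_iff_ae_eq_zero]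
    filter_upwards [hc] with a ha
    simp [ha, hc0]
  rw [hproj] at hlim
  have hsq := (hlim.norm.pow 2)
  simp only [norm_zero, ne_eq, OfNat.ofNat_ne_zero, not_false_eq_true, zero_pow] at hsq
  refine hsq.congr' ?_
  filter_upwards [eventually_ge_atTop 1] with n hn
  have hae : ∀ᵐ x ∂μ, (birkhoffAverage ℝ U _root_.id n ψ : Lp ℝ 2 μ) x
      = (∑ k ∈ Finset.range n, φ (T^[k] x)) / n - α := by
    have hk : ∀ k : ℕ, ∀ᵐ x ∂μ, (U^[k] ψ : Lp ℝ 2 μ) x = φ (T^[k] x) - α := by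
      intro k
      have : U^[k] ψ = Lp.compMeasurePreserving T^[k] (hT.toMeasurePreserving.iterate k) ψ := by
        rw [← Lp.compMeasurePreserving_iterate]
        rfl
      rw [this, hψdef, Lp.toLp_compMeasurePreserving]
      exact MemLp.coeFn_toLp _
    have hsum : ∀ m : ℕ, ∀ᵐ x ∂μ, (∑ k ∈ Finset.range m, U^[k] ψ : Lp ℝ 2 μ) x
        = ∑ k ∈ Finset.range m, (φ (T^[k] x) - α) := by
      intro m
      induction m with
      | zero =>
        filter_upwards [Lp.coeFn_zero ℝ 2 μ] with x hx
        simp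
      | succ m ih =>
        rw [Finset.sum_range_succ]
        filter_upwards [ih, hk m, Lp.coeFn_add (∑ k ∈ Finset.range m, U^[k] ψ) (U^[m] ψ)]
          with x h1 h2 h3
        rw [h3, Pi.add_apply, h1, h2, Finset.sum_range_succ]
    have hn0 : (n : ℝ) ≠ 0 := by positivity
    filter_upwards [hsum n, Lp.coeFn_smul ((n : ℝ)⁻¹) (∑ k ∈ Finset.range n, U^[k] ψ)] with x h1 h2
    have : birkhoffAverage ℝ U _root_.id n ψ = (n : ℝ)⁻¹ • ∑ k ∈ Finset.range n, U^[k] ψ := rfl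
    rw [this, h2, Pi.smul_apply, h1, Finset.sum_sub_distrib]
    simp only [Finset.sum_const, Finset.card_range, nsmul_eq_mul, smul_eq_mul]
    field_simp
  rw [← real_inner_self_eq_norm_sq, L2.inner_def]
  refine integral_congr_ae ?_
  filter_upwards [hae] with x hx
  rw [hx]
  simp [sq]


section SymbolicDynamics

variable {N K : ℕ} {M : Fin K → Fin K → Bool} {g : GaSp N K → ℝ} {D B : ℝ}

lemma shift_iterate_apply {α : Type*} (x : ℕ → α) (n t : ℕ) : (shift^[n] x) t = x (t + n) := by
  induction n generalizing t with
  | zero => rfl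
  | succ n ih =>
    rw [Function.iterate_succ_apply']
    change (shift^[n] x) (t + 1) = _
    rw [ih]
    congr 1
    omega

lemma shift2_iterate (p : GaSp N K) (n : ℕ) :
    shift2^[n] p = (shift^[n] p.1, shift^[n] p.2) := by
  induction n with
  | zero => rfl
  | succ n ih => simp only [Function.iterate_succ_apply', ih, shift2]

lemma shift_iterate_mem_SigmaA {x : ℕ → Fin K} (hx : x ∈ SigmaA M) (n : ℕ) :
    shift^[n] x ∈ SigmaA M := by
  intro k
  rw [shift_iterate_apply, shift_iterate_apply, add_right_comm]
  exact hx (k + n)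

lemma continuous_shift {α : Type*} [TopologicalSpace α] : Continuous (shift : (ℕ → α) → ℕ → α) :=
  continuous_pi fun n => continuous_apply (n + 1)

lemma continuous_shift2 : Continuous (shift2 : GaSp N K → GaSp N K) :=
  (continuous_shift.comp continuous_fst).prodMk (continuous_shift.comp continuous_snd)

lemma isClosed_SigmaA (M : Fin K → Fin K → Bool) : IsClosed (SigmaA M) := by
  have : SigmaA M = ⋂ k : ℕ, {x | M (x k) (x (k + 1)) = true} := by
    ext x
    simp [SigmaA]
  rw [this]
  refine isClosed_iInter fun k => ?_
  have hc : Continuous fun x : ℕ → Fin K => M (x k) (x (k + 1)) :=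
    (continuous_of_discreteTopology (f := fun q : Fin K × Fin K => M q.1 q.2)).comp
      (g := fun q : Fin K × Fin K => M q.1 q.2)
      ((continuous_apply (A := fun _ => Fin K) k).prodMk
        (continuous_apply (A := fun _ => Fin K) (k + 1)))
  exact isClosed_eq hc continuous_const

lemma isClosed_cyl {α : Type*} [TopologicalSpace α] [T1Space α] {n : ℕ} (w : Fin n → α) :
    IsClosed (cyl w) := by
  have : cyl w = ⋂ k : Fin n, {x | x (k : ℕ) = w k} := by
    ext x
    simp [cyl]
  rw [this]
  exact isClosed_iInter fun k => isClosed_singleton.preimage (continuous_apply _)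

lemma isClosed_setOf_snd_mem_SigmaA (M : Fin K → Fin K → Bool) :
    IsClosed {p : GaSp N K | p.2 ∈ SigmaA M} :=
  (isClosed_SigmaA M).preimage continuous_snd

lemma exists_abs_le_of_continuousOn (hg : ContinuousOn g {p : GaSp N K | p.2 ∈ SigmaA M}) :
    ∃ D : ℝ, 0 ≤ D ∧ ∀ p : GaSp N K, p.2 ∈ SigmaA M → |g p| ≤ D := by
  obtain ⟨D, hD⟩ := (isClosed_setOf_snd_mem_SigmaA M).isCompact.exists_bound_of_continuousOn hg
  exact ⟨max D 0, le_max_right _ _, fun p hp => (hD p hp).trans (le_max_left _ _)⟩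

lemma SnS_add (g : GaSp N K → ℝ) (n m : ℕ) (p : GaSp N K) :
    SnS g (n + m) p = SnS g n p + SnS g m (shift2^[n] p) := by
  simp only [SnS, Finset.sum_range_add, ← Function.iterate_add_apply]
  simp only [add_comm]

lemma abs_SnS_le (hD : ∀ p : GaSp N K, p.2 ∈ SigmaA M → |g p| ≤ D) (n : ℕ) {p : GaSp N K}
    (hp : p.2 ∈ SigmaA M) : |SnS g n p| ≤ n * D := by
  refine (Finset.abs_sum_le_sum_abs _ _).trans ?_
  have : ∀ k ∈ Finset.range n, |g (shift2^[k] p)| ≤ D := fun k _ =>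
    hD _ (by rw [shift2_iterate]; exact shift_iterate_mem_SigmaA hp k)
  simpa using Finset.sum_le_sum this

/-- `g` has bounded distortion with constant `B`: Birkhoff sums of length `n` vary by at most `B`
over product cylinders of length `n`. -/
def BddDistortion (M : Fin K → Fin K → Bool) (g : GaSp N K → ℝ) (B : ℝ) : Prop :=
  ∀ (n : ℕ) (p q : GaSp N K), p.2 ∈ SigmaA M → q.2 ∈ SigmaA M →
    (∀ t < n, p.1 t = q.1 t) → (∀ t < n, p.2 t = q.2 t) → SnS g n p ≤ SnS g n q + B

lemma BddVar.exists_bddDistortion (hg : BddVar M g)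
    (hD : ∀ p : GaSp N K, p.2 ∈ SigmaA M → |g p| ≤ D) :
    ∃ B : ℝ, 0 ≤ B ∧ BddDistortion M g B := by
  obtain ⟨B, hB⟩ := hg
  refine ⟨B, by simpa using hB 0, fun n p q hp hq h1 h2 => ?_⟩
  set V : ℕ → Set ℝ := fun k => {d : ℝ | ∃ p q : GaSp N K, p.2 ∈ SigmaA M ∧ q.2 ∈ SigmaA M ∧
        (∀ t < k, p.1 t = q.1 t) ∧ (∀ t < k, p.2 t = q.2 t) ∧ d = ‖g p - g q‖} with hV
  have hbdd : ∀ k, BddAbove (V k) := by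
    rintro k
    refine ⟨D + D, ?_⟩
    rintro d ⟨p, q, hp, hq, -, -, rfl⟩
    exact (norm_sub_le _ _).trans (add_le_add (hD p hp) (hD q hq))
  have hnonneg : ∀ k, 0 ≤ sSup (V k) := fun k => Real.sSup_nonneg (by
    rintro d ⟨p, q, -, -, -, -, rfl⟩
    exact norm_nonneg _)
  have hterm : ∀ k ∈ Finset.range n,
      g (shift2^[k] p) - g (shift2^[k] q) ≤ sSup (V (n - 1 - k + 1)) := by
    intro k hk
    rw [Finset.mem_range] at hk
    refine (le_abs_self _).trans (le_csSup (hbdd _)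
      ⟨shift2^[k] p, shift2^[k] q, ?_, ?_, ?_, ?_, rfl⟩)
    · rw [shift2_iterate]; exact shift_iterate_mem_SigmaA hp k
    · rw [shift2_iterate]; exact shift_iterate_mem_SigmaA hq k
    · intro t ht
      simp only [shift2_iterate, shift_iterate_apply]
      exact h1 _ (by omega)
    · intro t ht
      simp only [shift2_iterate, shift_iterate_apply]
      exact h2 _ (by omega)
  have hsum := Finset.sum_le_sum hterm
  rw [Finset.sum_sub_distrib, Finset.sum_range_reflect (fun k => sSup (V (k + 1)))] at hsum
  have htot := hB (n + 1)
  rw [Finset.sum_range_succ'] at htot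
  have h0 := hnonneg 0
  simp only [SnS]
  linarith

/-! ### Fibrewise suprema and partition functions -/

/-- The term `sup_{𝐣∈[𝐯]} e^{S_n g(𝐰,𝐣)}` of the fibrewise partition function. -/
noncomputable def fiberSup (M : Fin K → Fin K → Bool) (g : GaSp N K → ℝ) (w : ℕ → Fin N) {n : ℕ}
    (v : Fin n → Fin K) : ℝ :=
  sSup ((fun j => Real.exp (SnS g n (w, j))) '' {j | j ∈ SigmaA M ∧ ∀ k : Fin n, j (k : ℕ) = v k})

lemma Zn_eq_sum_fiberSup (w : ℕ → Fin N) (n : ℕ) :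
    Zn M g w n = ∑ v : Fin n → Fin K, fiberSup M g w v := rfl

lemma fiberSup_nonneg (w : ℕ → Fin N) {n : ℕ} (v : Fin n → Fin K) : 0 ≤ fiberSup M g w v :=
  Real.sSup_nonneg (by rintro _ ⟨j, -, rfl⟩; exact (Real.exp_pos _).le)

lemma fiberSup_le {w : ℕ → Fin N} {n : ℕ} {v : Fin n → Fin K} {c : ℝ} (hc : 0 ≤ c)
    (h : ∀ j ∈ SigmaA M, (∀ k : Fin n, j (k : ℕ) = v k) → Real.exp (SnS g n (w, j)) ≤ c) :
    fiberSup M g w v ≤ c :=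
  Real.sSup_le (by rintro _ ⟨j, hj, rfl⟩; exact h j hj.1 hj.2) hc

lemma exp_SnS_le_fiberSup (hD : ∀ p : GaSp N K, p.2 ∈ SigmaA M → |g p| ≤ D) {w : ℕ → Fin N} {n : ℕ}
    {v : Fin n → Fin K} {j : ℕ → Fin K} (hj : j ∈ SigmaA M) (hv : ∀ k : Fin n, j (k : ℕ) = v k) :
    Real.exp (SnS g n (w, j)) ≤ fiberSup M g w v := by
  refine le_csSup ⟨Real.exp (n * D), ?_⟩ ⟨j, ⟨hj, hv⟩, rfl⟩
  rintro _ ⟨i, hi, rfl⟩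
  exact Real.exp_le_exp.2 ((le_abs_self _).trans (abs_SnS_le hD n (p := (w, i)) hi.1))

lemma fiberSup_eq_zero {w : ℕ → Fin N} {n : ℕ} {v : Fin n → Fin K} (hv : ¬ AdmissibleWord M v) :
    fiberSup M g w v = 0 :=
  le_antisymm (fiberSup_le le_rfl fun j hj h => (hv ⟨j, hj, h⟩).elim) (fiberSup_nonneg _ _)

lemma exp_le_Zn (hne : (SigmaA M).Nonempty) (hD : ∀ p : GaSp N K, p.2 ∈ SigmaA M → |g p| ≤ D)
    (w : ℕ → Fin N) (n : ℕ) : Real.exp (-(n * D)) ≤ Zn M g w n := by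
  obtain ⟨j, hj⟩ := hne
  calc Real.exp (-(n * D)) ≤ Real.exp (SnS g n (w, j)) :=
        Real.exp_le_exp.2 (neg_le_of_abs_le (abs_SnS_le hD n (p := (w, j)) hj))
    _ ≤ fiberSup M g w (fun k : Fin n => j k) := exp_SnS_le_fiberSup hD hj fun _ => rfl
    _ ≤ Zn M g w n := Finset.single_le_sum (f := fun v : Fin n → Fin K => fiberSup M g w v)
        (fun v _ => fiberSup_nonneg w v) (Finset.mem_univ _)

lemma Zn_pos (hne : (SigmaA M).Nonempty) (hD : ∀ p : GaSp N K, p.2 ∈ SigmaA M → |g p| ≤ D)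
    (w : ℕ → Fin N) (n : ℕ) : 0 < Zn M g w n :=
  (Real.exp_pos _).trans_le (exp_le_Zn hne hD w n)

lemma Zn_le (hD : ∀ p : GaSp N K, p.2 ∈ SigmaA M → |g p| ≤ D) (w : ℕ → Fin N) (n : ℕ) :
    Zn M g w n ≤ (K : ℝ) ^ n * Real.exp (n * D) := by
  have : ∀ v ∈ (Finset.univ : Finset (Fin n → Fin K)), fiberSup M g w v ≤ Real.exp (n * D) :=
    fun v _ => fiberSup_le (Real.exp_pos _).le fun j hj _ =>
      Real.exp_le_exp.2 ((le_abs_self _).trans (abs_SnS_le hD n (p := (w, j)) hj))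
  simpa [Zn_eq_sum_fiberSup] using Finset.sum_le_sum this

lemma Zn_add_le (hD : ∀ p : GaSp N K, p.2 ∈ SigmaA M → |g p| ≤ D) (w : ℕ → Fin N) (n m : ℕ) :
    Zn M g w (n + m) ≤ Zn M g w n * Zn M g (shift^[n] w) m := by
  rw [Zn_eq_sum_fiberSup, Zn_eq_sum_fiberSup, Zn_eq_sum_fiberSup, Finset.sum_mul_sum,
    ← Fintype.sum_prod_type', ← (Fin.appendEquiv n m).sum_comp]
  refine Finset.sum_le_sum fun x _ => fiberSup_le
    (mul_nonneg (fiberSup_nonneg _ _) (fiberSup_nonneg _ _)) fun j hj h => ?_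
  rw [SnS_add, Real.exp_add, shift2_iterate]
  refine mul_le_mul (exp_SnS_le_fiberSup hD hj fun k => ?_)
    (exp_SnS_le_fiberSup hD (shift_iterate_mem_SigmaA hj n) fun k => ?_)
    (Real.exp_pos _).le (fiberSup_nonneg _ _)
  · simpa using h (Fin.castAdd m k)
  · rw [shift_iterate_apply]
    simpa [add_comm] using h (Fin.natAdd n k)

lemma Zn_sq_le (hD : ∀ p : GaSp N K, p.2 ∈ SigmaA M → |g p| ≤ D) {h : GaSp N K → ℝ} {D' : ℝ}
    (hD' : ∀ p : GaSp N K, p.2 ∈ SigmaA M → |h p| ≤ D') (w : ℕ → Fin N) (n : ℕ) :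
    Zn M (fun p => (g p + h p) / 2) w n ^ 2 ≤ Zn M g w n * Zn M h w n := by
  have hsum : ∀ p, SnS (fun p => (g p + h p) / 2) n p = (SnS g n p + SnS h n p) / 2 := by
    intro p
    simp only [SnS, ← Finset.sum_div, Finset.sum_add_distrib]
  have hle : Zn M (fun p => (g p + h p) / 2) w n ≤ √(Zn M g w n) * √(Zn M h w n) := by
    refine le_trans (Finset.sum_le_sum fun v _ => ?_)
      (Real.sum_sqrt_mul_sqrt_le _ (fiberSup_nonneg (M := M) (g := g) w)
        (fiberSup_nonneg (M := M) (g := h) w))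
    refine fiberSup_le (by positivity) fun j hj hv => ?_
    rw [hsum, add_div, Real.exp_add, Real.exp_half, Real.exp_half]
    gcongr
    · exact exp_SnS_le_fiberSup hD hj hv
    · exact exp_SnS_le_fiberSup hD' hj hv
  have h0 : ∀ u : GaSp N K → ℝ, 0 ≤ Zn M u w n := fun u =>
    Finset.sum_nonneg fun v _ => fiberSup_nonneg (M := M) (g := u) w v
  calc _ ≤ (√(Zn M g w n) * √(Zn M h w n)) ^ 2 := by
        gcongr
        exact h0 _
    _ = _ := by rw [mul_pow, Real.sq_sqrt (h0 _), Real.sq_sqrt (h0 _)]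

lemma continuous_Zn (hg : ContinuousOn g {p : GaSp N K | p.2 ∈ SigmaA M}) (n : ℕ) :
    Continuous fun w : ℕ → Fin N => Zn M g w n := by
  refine continuous_finsetSum _ fun v _ => ?_
  set S : Set (SigmaA M) := {j | ∀ k : Fin n, (j : ℕ → Fin K) (k : ℕ) = v k} with hS
  have hcomp : CompactSpace (SigmaA M) := isCompact_iff_compactSpace.1 (isClosed_SigmaA M).isCompact
  have hSc : IsCompact S := ((isClosed_cyl v).preimage continuous_subtype_val).isCompact
  have hcont : Continuous ↿(fun (w : ℕ → Fin N) (j : SigmaA M) => Real.exp (SnS g n (w, j))) := by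
    refine Real.continuous_exp.comp (continuous_finsetSum _ fun k _ => ?_)
    refine hg.comp_continuous
      (f := fun q : (ℕ → Fin N) × SigmaA M => shift2^[k] (q.1, (q.2 : ℕ → Fin K)))
      ((continuous_shift2.iterate k).comp
        (continuous_fst.prodMk (continuous_subtype_val.comp continuous_snd))) fun q => ?_
    rw [shift2_iterate]
    exact shift_iterate_mem_SigmaA q.2.2 k
  refine (hSc.continuous_sSup hcont).congr fun w => ?_
  congr 1
  ext d
  constructor
  · rintro ⟨j, hj, rfl⟩
    exact ⟨j, ⟨j.2, hj⟩, rfl⟩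
  · rintro ⟨j, hj, rfl⟩
    exact ⟨⟨j, hj.1⟩, hj.2, rfl⟩

/-! ### Supermultiplicativity of the partition functions -/

lemma ApIrr.nonempty_SigmaA (hA : ApIrr M) (i : Fin K) : (SigmaA M).Nonempty := by
  obtain ⟨r, hr, h⟩ := hA
  have hsucc : ∀ i : Fin K, ∃ j, M i j = true := fun i => by
    obtain ⟨p, h0, -, hp⟩ := h i i
    exact ⟨p 1, h0 ▸ hp 0 hr⟩
  choose s hs using hsucc
  exact ⟨fun k => s^[k] i, fun k => by
    simp only [Function.iterate_succ_apply', hs]⟩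

lemma exists_glue {s : ℕ} (hs : ∀ i j : Fin K, ∃ p : ℕ → Fin K, p 0 = i ∧ p (s + 1) = j ∧
    ∀ k < s + 1, M (p k) (p (k + 1)) = true) {x y : ℕ → Fin K} (hx : x ∈ SigmaA M)
    (hy : y ∈ SigmaA M) {n : ℕ} (hn : n ≠ 0) :
    ∃ u ∈ SigmaA M, (∀ k < n, u k = x k) ∧ ∀ k, s ≤ k → u (n + k) = y k := by
  obtain ⟨n, rfl⟩ := Nat.exists_eq_succ_of_ne_zero hn
  obtain ⟨p, hp0, hps, hp⟩ := hs (x n) (y s)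
  refine ⟨fun k => if k < n then x k else if k ≤ n + s then p (k - n) else y (k - (n + 1)),
    fun k => ?_, fun k hk => ?_, fun k hk => ?_⟩
  · dsimp only
    rcases lt_trichotomy (k + 1) n with h | h | h
    · rw [if_pos (by omega), if_pos h]
      exact hx k
    · rw [if_pos (by omega), if_neg (by omega), if_pos (by omega), h, Nat.sub_self, hp0, ← h]
      exact hx k
    · rw [if_neg (show ¬ k < n by omega), if_neg (show ¬ k + 1 < n by omega)]
      rcases lt_trichotomy k (n + s) with h' | h' | h'
      · rw [if_pos (show k ≤ n + s by omega), if_pos (show k + 1 ≤ n + s by omega),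
          Nat.sub_add_comm (by omega)]
        exact hp _ (by omega)
      · rw [if_pos (show k ≤ n + s by omega), if_neg (show ¬ k + 1 ≤ n + s by omega),
          show k + 1 - (n + 1) = s by omega, ← hps, show k - n = s by omega]
        exact hp _ (by omega)
      · rw [if_neg (show ¬ k ≤ n + s by omega), if_neg (show ¬ k + 1 ≤ n + s by omega),
          Nat.sub_add_comm (by omega)]
        exact hy _
  · dsimp only
    split_ifs with h1 h2
    · rfl
    · rw [show k = n by omega, Nat.sub_self, hp0]
    · omega
  · dsimp only
    rw [if_neg (by omega), if_neg (by omega)]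
    congr 1
    omega

lemma SnS_le_of_eventually_agree (hD : ∀ p : GaSp N K, p.2 ∈ SigmaA M → |g p| ≤ D)
    (hB0 : 0 ≤ B) (hB : BddDistortion M g B) (s m : ℕ) (w : ℕ → Fin N) {x y : ℕ → Fin K}
    (hx : x ∈ SigmaA M) (hy : y ∈ SigmaA M) (h : ∀ k, s ≤ k → k < m → x k = y k) :
    SnS g m (w, x) ≤ SnS g m (w, y) + (2 * (s * D) + B) := by
  have hD0 : 0 ≤ D := (abs_nonneg _).trans (hD (w, x) hx)
  have bound : ∀ l : ℕ, SnS g l (w, x) ≤ SnS g l (w, y) + 2 * (l * D) := fun l => by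
    linarith [(abs_le.1 (abs_SnS_le hD l (p := (w, x)) hx)).2,
      (abs_le.1 (abs_SnS_le hD l (p := (w, y)) hy)).1]
  rcases le_total m s with hms | hms
  · have : (m : ℝ) * D ≤ s * D := by gcongr
    linarith [bound m]
  · obtain ⟨l, rfl⟩ := Nat.exists_eq_add_of_le hms
    rw [SnS_add, SnS_add, shift2_iterate, shift2_iterate]
    have := hB l (shift^[s] w, shift^[s] x) (shift^[s] w, shift^[s] y)
      (shift_iterate_mem_SigmaA hx s) (shift_iterate_mem_SigmaA hy s) (fun _ _ => rfl)
      (fun t ht => by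
        simp only [shift_iterate_apply]
        exact h _ (by omega) (by omega))
    linarith [bound s]

lemma exists_glue_word {s : ℕ} (hs : ∀ i j : Fin K, ∃ p : ℕ → Fin K, p 0 = i ∧ p (s + 1) = j ∧
    ∀ k < s + 1, M (p k) (p (k + 1)) = true)
    (hD : ∀ p : GaSp N K, p.2 ∈ SigmaA M → |g p| ≤ D) (hB0 : 0 ≤ B) (hB : BddDistortion M g B)
    {n m : ℕ} (hn : n ≠ 0) (v : Fin n → Fin K) (v' : Fin m → Fin K) :
    ∃ u : Fin (n + m) → Fin K, (∀ k : Fin n, u (Fin.castAdd m k) = v k) ∧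
      (∀ k : Fin m, s ≤ (k : ℕ) → u (Fin.natAdd n k) = v' k) ∧
      ∀ w : ℕ → Fin N, fiberSup M g w v * fiberSup M g (shift^[n] w) v' ≤
        Real.exp (B + (2 * (s * D) + B)) * fiberSup M g w u := by
  by_cases hv : AdmissibleWord M v ∧ AdmissibleWord M v'
  · obtain ⟨⟨x, hx, hxv⟩, y, hy, hyv⟩ := hv
    obtain ⟨u, hu, hu1, hu2⟩ := exists_glue hs hx hy hn
    refine ⟨fun k => u k, fun k => (hu1 k k.2).trans (hxv k),
      fun k hk => (hu2 k hk).trans (hyv k), fun w => ?_⟩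
    have h1 : fiberSup M g w v ≤ Real.exp (SnS g n (w, u) + B) :=
      fiberSup_le (Real.exp_pos _).le fun j hj hjv => Real.exp_le_exp.2 <|
        hB n (w, j) (w, u) hj hu (fun _ _ => rfl) fun t ht => by
          dsimp only
          rw [hu1 t ht, hxv ⟨t, ht⟩, hjv ⟨t, ht⟩]
    have h2 : fiberSup M g (shift^[n] w) v' ≤
        Real.exp (SnS g m (shift^[n] w, shift^[n] u) + (2 * (s * D) + B)) :=
      fiberSup_le (Real.exp_pos _).le fun j hj hjv => Real.exp_le_exp.2 <|
        SnS_le_of_eventually_agree hD hB0 hB s m _ hj (shift_iterate_mem_SigmaA hu n)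
          fun k hk hkm => by
            rw [shift_iterate_apply, add_comm, hu2 k hk, hyv ⟨k, hkm⟩, hjv ⟨k, hkm⟩]
    calc fiberSup M g w v * fiberSup M g (shift^[n] w) v'
        ≤ Real.exp (SnS g n (w, u) + B) *
            Real.exp (SnS g m (shift^[n] w, shift^[n] u) + (2 * (s * D) + B)) :=
          mul_le_mul h1 h2 (fiberSup_nonneg _ _) (Real.exp_pos _).le
      _ = Real.exp (B + (2 * (s * D) + B)) * Real.exp (SnS g (n + m) (w, u)) := by
          rw [SnS_add, shift2_iterate, ← Real.exp_add, ← Real.exp_add]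
          congr 1
          ring
      _ ≤ _ := by
          gcongr
          exact exp_SnS_le_fiberSup hD hu fun _ => rfl
  · refine ⟨Fin.append v v', fun k => Fin.append_left _ _ k, fun k _ => Fin.append_right _ _ k,
      fun w => ?_⟩
    have : fiberSup M g w v * fiberSup M g (shift^[n] w) v' = 0 := by
      rcases not_and_or.1 hv with h | h
      · rw [fiberSup_eq_zero h, zero_mul]
      · rw [fiberSup_eq_zero h, mul_zero]
    rw [this]
    exact mul_nonneg (Real.exp_pos _).le (fiberSup_nonneg _ _)

lemma ApIrr.exists_Zn_mul_Zn_le (hA : ApIrr M) (hne : (SigmaA M).Nonempty)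
    (hD : ∀ p : GaSp N K, p.2 ∈ SigmaA M → |g p| ≤ D) (hB0 : 0 ≤ B) (hB : BddDistortion M g B) :
    ∃ C : ℝ, 0 ≤ C ∧ ∀ (w : ℕ → Fin N) (n m : ℕ),
      Zn M g w n * Zn M g (shift^[n] w) m ≤ Real.exp C * Zn M g w (n + m) := by
  obtain ⟨j₀, hj₀⟩ := id hne
  obtain ⟨r, hr, hs⟩ := hA
  obtain ⟨s, rfl⟩ := Nat.exists_eq_succ_of_ne_zero hr.ne'
  have hK : (1 : ℝ) ≤ K := by
    have : 0 < K := (j₀ 0).pos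
    exact_mod_cast this
  refine ⟨|B + (2 * (s * D) + B)| + Real.log ((K : ℝ) ^ s),
    add_nonneg (abs_nonneg _) (Real.log_nonneg (one_le_pow₀ hK)), fun w n m => ?_⟩
  rw [Real.exp_add, Real.exp_log (by positivity)]
  have hZ := (Zn_pos hne hD w (n + m)).le
  rcases eq_or_ne n 0 with rfl | hn
  · have h1 : Zn M g w 0 ≤ 1 := by simpa using Zn_le hD w 0
    have h2 : 1 ≤ Real.exp |B + (2 * (s * D) + B)| * (K : ℝ) ^ s :=
      one_le_mul_of_one_le_of_one_le (Real.one_le_exp (abs_nonneg _)) (one_le_pow₀ hK)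
    rw [Function.iterate_zero, id, zero_add] at *
    exact mul_le_mul_of_nonneg_right (h1.trans h2) hZ
  choose u hu1 hu2 hu using fun (v : Fin n → Fin K) (v' : Fin m → Fin K) =>
    exists_glue_word hs hD hB0 hB hn v v'
  set Φ : (Fin n → Fin K) × (Fin m → Fin K) → (Fin (n + m) → Fin K) × (Fin s → Fin K) :=
    fun q => (u q.1 q.2, fun k => if h : (k : ℕ) < m then q.2 ⟨k, h⟩ else j₀ 0) with hΦ
  have hinj : Function.Injective Φ := by
    rintro ⟨v₁, v₁'⟩ ⟨v₂, v₂'⟩ h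
    obtain ⟨ha, hb⟩ := Prod.ext_iff.1 h
    refine Prod.ext (funext fun k => ?_) (funext fun k => ?_)
    · have := congr_fun ha (Fin.castAdd m k)
      simp only [hΦ, hu1] at this
      exact this
    · rcases lt_or_ge (k : ℕ) s with hk | hk
      · have := congr_fun hb ⟨k, hk⟩
        simpa [hΦ] using this
      · have := congr_fun ha (Fin.natAdd n k)
        simp only [hΦ] at this
        rwa [hu2 _ _ _ hk, hu2 _ _ _ hk] at this
  calc Zn M g w n * Zn M g (shift^[n] w) m
      = ∑ q : (Fin n → Fin K) × (Fin m → Fin K),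
          fiberSup M g w q.1 * fiberSup M g (shift^[n] w) q.2 := by
        rw [Zn_eq_sum_fiberSup, Zn_eq_sum_fiberSup, Finset.sum_mul_sum, ← Fintype.sum_prod_type']
    _ ≤ ∑ q : (Fin n → Fin K) × (Fin m → Fin K),
          Real.exp |B + (2 * (s * D) + B)| * fiberSup M g w (Φ q).1 := by
        refine Finset.sum_le_sum fun q _ => (hu q.1 q.2 w).trans ?_
        refine mul_le_mul_of_nonneg_right ?_ (fiberSup_nonneg _ _)
        exact Real.exp_le_exp.2 (le_abs_self _)
    _ ≤ ∑ q : (Fin (n + m) → Fin K) × (Fin s → Fin K),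
          Real.exp |B + (2 * (s * D) + B)| * fiberSup M g w q.1 := by
        rw [← Finset.sum_image (f := fun q : (Fin (n + m) → Fin K) × (Fin s → Fin K) =>
          Real.exp |B + (2 * (s * D) + B)| * fiberSup M g w q.1) (g := Φ) hinj.injOn]
        exact Finset.sum_le_sum_of_subset_of_nonneg (Finset.subset_univ _) fun q _ _ =>
          mul_nonneg (Real.exp_pos _).le (fiberSup_nonneg _ _)
    _ = _ := by
        rw [Fintype.sum_prod_type]
        simp only [Finset.sum_const, Finset.card_univ, Fintype.card_fun, Fintype.card_fin,
          nsmul_eq_mul, ← Finset.mul_sum]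
        rw [Zn_eq_sum_fiberSup]
        push_cast
        ring

/-! ### The conditional pressure as a limit -/

variable {ν : Measure (ℕ → Fin N)}

lemma abs_log_Zn_le (hne : (SigmaA M).Nonempty)
    (hD : ∀ p : GaSp N K, p.2 ∈ SigmaA M → |g p| ≤ D) (w : ℕ → Fin N) (n : ℕ) :
    |Real.log (Zn M g w n)| ≤ n * (D + Real.log K) := by
  have hK : (1 : ℝ) ≤ K := by
    have : 0 < K := (hne.some 0).pos
    exact_mod_cast this
  have hlogK := Real.log_nonneg hK
  have hZ := Zn_pos hne hD w n
  have h1 : -(n * D) ≤ Real.log (Zn M g w n) := (Real.le_log_iff_exp_le hZ).2 (exp_le_Zn hne hD w n)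
  have h2 : Real.log (Zn M g w n) ≤ n * Real.log K + n * D := by
    have := Real.log_le_log hZ (Zn_le hD w n)
    rwa [Real.log_mul (by positivity) (Real.exp_pos _).ne', Real.log_exp, Real.log_pow] at this
  have h3 : 0 ≤ n * Real.log K := by positivity
  rw [abs_le]
  constructor <;> linarith

lemma integrable_log_Zn [IsProbabilityMeasure ν] (hne : (SigmaA M).Nonempty)
    (hg : ContinuousOn g {p : GaSp N K | p.2 ∈ SigmaA M}) (n : ℕ) :
    Integrable (fun w => Real.log (Zn M g w n)) ν := by
  obtain ⟨D, -, hD⟩ := exists_abs_le_of_continuousOn hg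
  exact Integrable.of_bound
    ((continuous_Zn hg n).measurable.log).aestronglyMeasurable (n * (D + Real.log K))
    (Eventually.of_forall fun w => abs_log_Zn_le hne hD w n)

lemma integral_log_Zn_iterate (hinv : MeasurePreserving shift ν ν)
    (hg : ContinuousOn g {p : GaSp N K | p.2 ∈ SigmaA M}) (n m : ℕ) :
    ∫ w, Real.log (Zn M g (shift^[n] w) m) ∂ν = ∫ w, Real.log (Zn M g w m) ∂ν := by
  have hmp := hinv.iterate n
  have := integral_map (μ := ν) (φ := shift^[n]) hmp.measurable.aemeasurable
    (f := fun w => Real.log (Zn M g w m))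
    ((continuous_Zn hg m).measurable.log).aestronglyMeasurable
  rw [hmp.map_eq] at this
  exact this.symm

lemma abs_integral_log_Zn_div_le [IsProbabilityMeasure ν] (hne : (SigmaA M).Nonempty)
    (hD : ∀ p : GaSp N K, p.2 ∈ SigmaA M → |g p| ≤ D) :
    ∀ n : ℕ, |(∫ w, Real.log (Zn M g w n) ∂ν) / n| ≤ |D + Real.log K| := by
  intro n
  have h : ‖∫ w, Real.log (Zn M g w n) ∂ν‖ ≤ n * (D + Real.log K) := by
    simpa using norm_integral_le_of_norm_le_const (μ := ν) (C := n * (D + Real.log K))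
      (f := fun w => Real.log (Zn M g w n))
      (Eventually.of_forall fun w => by rw [Real.norm_eq_abs]; exact abs_log_Zn_le hne hD w n)
  rcases eq_or_ne n 0 with rfl | hn
  · simp
  · have hn' : (0 : ℝ) < n := by positivity
    rw [abs_div, Nat.abs_cast, div_le_iff₀ hn', mul_comm]
    exact h.trans (mul_le_mul_of_nonneg_left (le_abs_self _) hn'.le)

lemma subadditive_integral_log_Zn [IsProbabilityMeasure ν] (hne : (SigmaA M).Nonempty)
    (hinv : MeasurePreserving shift ν ν)
    (hg : ContinuousOn g {p : GaSp N K | p.2 ∈ SigmaA M}) :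
    Subadditive fun n => ∫ w, Real.log (Zn M g w n) ∂ν := by
  obtain ⟨D, -, hD⟩ := exists_abs_le_of_continuousOn hg
  intro n m
  dsimp only
  have hint : Integrable (fun w => Real.log (Zn M g (shift^[n] w) m)) ν :=
    (hinv.iterate n).integrable_comp_of_integrable (integrable_log_Zn hne hg m)
  rw [← integral_log_Zn_iterate hinv hg n m, ← integral_add (integrable_log_Zn hne hg n) hint]
  refine integral_mono (integrable_log_Zn hne hg _) ((integrable_log_Zn hne hg n).add hint)
    fun w => ?_
  dsimp only
  rw [← Real.log_mul (Zn_pos hne hD _ _).ne' (Zn_pos hne hD _ _).ne']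
  exact Real.log_le_log (Zn_pos hne hD _ _) (Zn_add_le hD w n m)

lemma tendsto_condPressure [IsProbabilityMeasure ν] (hne : (SigmaA M).Nonempty)
    (hinv : MeasurePreserving shift ν ν)
    (hg : ContinuousOn g {p : GaSp N K | p.2 ∈ SigmaA M}) :
    Tendsto (fun n : ℕ => (∫ w, Real.log (Zn M g w n) ∂ν) / n) atTop
      (nhds (condPressure M ν g)) := by
  obtain ⟨D, -, hD⟩ := exists_abs_le_of_continuousOn hg
  have h := (subadditive_integral_log_Zn hne hinv hg).tendsto_lim
    ⟨-|D + Real.log K|, by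
      rintro _ ⟨n, rfl⟩
      exact (abs_le.1 (abs_integral_log_Zn_div_le hne hD n)).1⟩
  rwa [condPressure, h.limsup_eq]

lemma condPressure_le_div [IsProbabilityMeasure ν] (hne : (SigmaA M).Nonempty)
    (hinv : MeasurePreserving shift ν ν)
    (hg : ContinuousOn g {p : GaSp N K | p.2 ∈ SigmaA M}) {n : ℕ} (hn : n ≠ 0) :
    condPressure M ν g ≤ (∫ w, Real.log (Zn M g w n) ∂ν) / n := by
  obtain ⟨D, -, hD⟩ := exists_abs_le_of_continuousOn hg
  have hb : BddBelow (range fun n : ℕ => (∫ w, Real.log (Zn M g w n) ∂ν) / n) :=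
    ⟨-|D + Real.log K|, by
      rintro _ ⟨n, rfl⟩
      exact (abs_le.1 (abs_integral_log_Zn_div_le hne hD n)).1⟩
  have hsub := subadditive_integral_log_Zn hne hinv hg
  rw [tendsto_nhds_unique (tendsto_condPressure hne hinv hg) (hsub.tendsto_lim hb)]
  exact hsub.lim_le_div hb hn

lemma ApIrr.exists_div_le_condPressure [IsProbabilityMeasure ν] (hA : ApIrr M)
    (hne : (SigmaA M).Nonempty) (hinv : MeasurePreserving shift ν ν)
    (hg : ContinuousOn g {p : GaSp N K | p.2 ∈ SigmaA M}) (hB0 : 0 ≤ B)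
    (hB : BddDistortion M g B) :
    ∃ C : ℝ, 0 ≤ C ∧ ∀ n : ℕ, n ≠ 0 →
      ((∫ w, Real.log (Zn M g w n) ∂ν) - C) / n ≤ condPressure M ν g := by
  obtain ⟨D, -, hD⟩ := exists_abs_le_of_continuousOn hg
  obtain ⟨C, hC0, hC⟩ := hA.exists_Zn_mul_Zn_le hne hD hB0 hB
  refine ⟨C, hC0, fun n hn => ?_⟩
  have hsub : Subadditive fun n => C - ∫ w, Real.log (Zn M g w n) ∂ν := by
    intro n m
    have hint : Integrable (fun w => Real.log (Zn M g (shift^[n] w) m)) ν :=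
      (hinv.iterate n).integrable_comp_of_integrable (integrable_log_Zn hne hg m)
    have h : ∫ w, (Real.log (Zn M g w n) + Real.log (Zn M g (shift^[n] w) m)) ∂ν ≤
        ∫ w, (C + Real.log (Zn M g w (n + m))) ∂ν := by
      refine integral_mono ((integrable_log_Zn hne hg n).add hint)
        ((integrable_const C).add (integrable_log_Zn hne hg _)) fun w => ?_
      dsimp only
      rw [← Real.log_mul (Zn_pos hne hD _ _).ne' (Zn_pos hne hD _ _).ne', ← Real.log_exp C,
        ← Real.log_mul (Real.exp_pos _).ne' (Zn_pos hne hD _ _).ne']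
      exact Real.log_le_log (mul_pos (Zn_pos hne hD _ _) (Zn_pos hne hD _ _)) (hC w n m)
    rw [integral_add (integrable_log_Zn hne hg n) hint,
      integral_add (integrable_const C) (integrable_log_Zn hne hg _),
      integral_log_Zn_iterate hinv hg] at h
    simp only [integral_const, probReal_univ, one_smul] at h
    dsimp only
    linarith
  have hlim : Tendsto (fun n : ℕ => (C - ∫ w, Real.log (Zn M g w n) ∂ν) / n) atTop
      (nhds (-condPressure M ν g)) := by
    have h := (tendsto_const_div_atTop_nhds_zero_nat C).sub (tendsto_condPressure hne hinv hg)
    rw [zero_sub] at h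
    simpa only [sub_div] using h
  have hb : BddBelow (range fun n : ℕ => (C - ∫ w, Real.log (Zn M g w n) ∂ν) / n) :=
    hlim.bddBelow_range
  have hle := hsub.lim_le_div hb hn
  rw [← tendsto_nhds_unique hlim (hsub.tendsto_lim hb)] at hle
  rw [← neg_sub, neg_div]
  linarith

lemma two_mul_condPressure_le [IsProbabilityMeasure ν] (hne : (SigmaA M).Nonempty)
    (hinv : MeasurePreserving shift ν ν) {h : GaSp N K → ℝ}
    (hg : ContinuousOn g {p : GaSp N K | p.2 ∈ SigmaA M})
    (hh : ContinuousOn h {p : GaSp N K | p.2 ∈ SigmaA M}) :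
    2 * condPressure M ν (fun p => (g p + h p) / 2) ≤ condPressure M ν g + condPressure M ν h := by
  obtain ⟨D, -, hD⟩ := exists_abs_le_of_continuousOn hg
  obtain ⟨D', -, hD'⟩ := exists_abs_le_of_continuousOn hh
  have hgh : ContinuousOn (fun p => (g p + h p) / 2) {p : GaSp N K | p.2 ∈ SigmaA M} :=
    (hg.add hh).div_const 2
  obtain ⟨D'', -, hD''⟩ := exists_abs_le_of_continuousOn hgh
  refine le_of_tendsto_of_tendsto' ((tendsto_condPressure hne hinv hgh).const_mul 2)
    ((tendsto_condPressure hne hinv hg).add (tendsto_condPressure hne hinv hh)) fun n => ?_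
  rw [← mul_div_assoc, ← add_div]
  gcongr
  rw [← integral_const_mul,
    ← integral_add (integrable_log_Zn hne hg n) (integrable_log_Zn hne hh n)]
  refine integral_mono ((integrable_log_Zn hne hgh n).const_mul 2)
    ((integrable_log_Zn hne hg n).add (integrable_log_Zn hne hh n)) fun w => ?_
  have h2 := Real.log_le_log (pow_pos (Zn_pos hne hD'' w n) 2) (Zn_sq_le hD hD' w n)
  rw [Real.log_pow, Real.log_mul (Zn_pos hne hD _ _).ne' (Zn_pos hne hD' _ _).ne'] at h2
  exact_mod_cast h2

/-! ### Cylinder partitions -/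

lemma measurableSet_cyl {α : Type*} [MeasurableSpace α] [MeasurableSingletonClass α] {n : ℕ}
    (w : Fin n → α) : MeasurableSet (cyl w) := by
  have : cyl w = ⋂ k : Fin n, (fun x : ℕ → α => x k) ⁻¹' {w k} := by
    ext x
    simp [cyl]
  rw [this]
  exact MeasurableSet.iInter fun k => measurable_pi_apply _ (measurableSet_singleton _)

lemma measurableSet_cylP {n : ℕ} (w : Fin n → Fin N) (v : Fin n → Fin K) :
    MeasurableSet (cylP w v) :=
  (measurable_fst (measurableSet_cyl w)).inter (measurable_snd (measurableSet_cyl v))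

lemma pairwise_disjoint_cyl {α : Type*} (n : ℕ) :
    Pairwise (Function.onFun Disjoint fun w : Fin n → α => cyl w) := by
  intro w w' hw
  refine Set.disjoint_left.2 fun x hx hx' => hw (funext fun k => ?_)
  rw [← hx k, ← hx' k]

lemma pairwise_disjoint_cylP (n : ℕ) :
    Pairwise (Function.onFun Disjoint
      fun q : (Fin n → Fin N) × (Fin n → Fin K) => cylP q.1 q.2) := by
  intro q q' hq
  refine Set.disjoint_left.2 fun x hx hx' => hq (Prod.ext (funext fun k => ?_) (funext fun k => ?_))
  · rw [← hx.1 k, ← hx'.1 k]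
  · rw [← hx.2 k, ← hx'.2 k]

lemma sum_setIntegral_cyl {F : (ℕ → Fin N) → ℝ} (hF : Integrable F ν) (n : ℕ) :
    ∑ w : Fin n → Fin N, ∫ z in cyl w, F z ∂ν = ∫ z, F z ∂ν := by
  rw [← integral_iUnion_fintype (fun w => measurableSet_cyl w) (pairwise_disjoint_cyl n)
    fun w => hF.integrableOn]
  have : (⋃ w : Fin n → Fin N, cyl w) = univ :=
    eq_univ_of_forall fun z => mem_iUnion.2 ⟨fun k => z k, fun _ => rfl⟩
  rw [this, setIntegral_univ]

lemma sum_setIntegral_cylP {μ : Measure (GaSp N K)} {F : GaSp N K → ℝ} (hF : Integrable F μ)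
    (n : ℕ) :
    ∑ w : Fin n → Fin N, ∑ v : Fin n → Fin K, ∫ p in cylP w v, F p ∂μ = ∫ p, F p ∂μ := by
  rw [← Fintype.sum_prod_type' (f := fun (w : Fin n → Fin N) (v : Fin n → Fin K) =>
    ∫ p in cylP w v, F p ∂μ), ← integral_iUnion_fintype
    (s := fun q : (Fin n → Fin N) × (Fin n → Fin K) => cylP q.1 q.2)
    (fun q => measurableSet_cylP q.1 q.2)
    (pairwise_disjoint_cylP n) fun q => hF.integrableOn]
  have : (⋃ q : (Fin n → Fin N) × (Fin n → Fin K), cylP q.1 q.2) = univ :=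
    eq_univ_of_forall fun p => mem_iUnion.2 ⟨(fun k => p.1 k, fun k => p.2 k),
      fun _ => rfl, fun _ => rfl⟩
  rw [this, setIntegral_univ]

/-! ### Comparison of `Y`, `W` and `Z` -/

lemma Yfun_nonneg {n : ℕ} (w : Fin n → Fin N) (v : Fin n → Fin K) : 0 ≤ Yfun M g w v :=
  Real.sSup_nonneg (by rintro _ ⟨p, -, rfl⟩; exact (Real.exp_pos _).le)

lemma exp_SnS_le_Yfun (hD : ∀ p : GaSp N K, p.2 ∈ SigmaA M → |g p| ≤ D) {n : ℕ}
    {w : Fin n → Fin N} {v : Fin n → Fin K} {z : ℕ → Fin N} (hz : z ∈ cyl w) {j : ℕ → Fin K}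
    (hj : j ∈ SigmaA M) (hv : j ∈ cyl v) : Real.exp (SnS g n (z, j)) ≤ Yfun M g w v := by
  refine le_csSup ⟨Real.exp (n * D), ?_⟩ ⟨(z, j), ⟨hz, hj, hv⟩, rfl⟩
  rintro _ ⟨p, hp, rfl⟩
  exact Real.exp_le_exp.2 ((le_abs_self _).trans (abs_SnS_le hD n hp.2.1))

lemma fiberSup_le_Yfun (hD : ∀ p : GaSp N K, p.2 ∈ SigmaA M → |g p| ≤ D) {n : ℕ}
    {w : Fin n → Fin N} (v : Fin n → Fin K) {z : ℕ → Fin N} (hz : z ∈ cyl w) :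
    fiberSup M g z v ≤ Yfun M g w v :=
  fiberSup_le (Yfun_nonneg _ _) fun _ hj hv => exp_SnS_le_Yfun hD hz hj hv

lemma Yfun_eq_zero {n : ℕ} {w : Fin n → Fin N} {v : Fin n → Fin K} (hv : ¬ AdmissibleWord M v) :
    Yfun M g w v = 0 := by
  refine le_antisymm (Real.sSup_le ?_ le_rfl) (Yfun_nonneg _ _)
  rintro _ ⟨p, hp, rfl⟩
  exact (hv ⟨p.2, hp.2.1, hp.2.2⟩).elim

lemma Wfun_le_sum_Yfun (hD : ∀ p : GaSp N K, p.2 ∈ SigmaA M → |g p| ≤ D) {n : ℕ}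
    (w : Fin n → Fin N) : Wfun M g w ≤ ∑ v : Fin n → Fin K, Yfun M g w v := by
  refine Real.sSup_le ?_ (Finset.sum_nonneg fun v _ => Yfun_nonneg w v)
  rintro _ ⟨z, hz, rfl⟩
  exact Finset.sum_le_sum fun v _ => fiberSup_le_Yfun hD v hz

lemma Zn_le_Wfun (hD : ∀ p : GaSp N K, p.2 ∈ SigmaA M → |g p| ≤ D) {n : ℕ}
    {w : Fin n → Fin N} {z : ℕ → Fin N} (hz : z ∈ cyl w) : Zn M g z n ≤ Wfun M g w := by
  refine le_csSup ⟨(K : ℝ) ^ n * Real.exp (n * D), ?_⟩ ⟨z, hz, rfl⟩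
  rintro _ ⟨z', -, rfl⟩
  exact Zn_le hD z' n

lemma BddDistortion.Zn_le (hB : BddDistortion M g B)
    (hD : ∀ p : GaSp N K, p.2 ∈ SigmaA M → |g p| ≤ D) {n : ℕ}
    {w : Fin n → Fin N} {z z' : ℕ → Fin N} (hz : z ∈ cyl w) (hz' : z' ∈ cyl w) :
    Zn M g z' n ≤ Real.exp B * Zn M g z n := by
  rw [Zn_eq_sum_fiberSup, Zn_eq_sum_fiberSup, Finset.mul_sum]
  refine Finset.sum_le_sum fun v _ =>
    fiberSup_le (mul_nonneg (Real.exp_pos _).le (fiberSup_nonneg _ _)) fun j hj hv => ?_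
  calc Real.exp (SnS g n (z', j)) ≤ Real.exp (SnS g n (z, j) + B) :=
        Real.exp_le_exp.2 <| hB n (z', j) (z, j) hj hj
          (fun t ht => (hz' ⟨t, ht⟩).trans (hz ⟨t, ht⟩).symm) fun _ _ => rfl
    _ = Real.exp B * Real.exp (SnS g n (z, j)) := by rw [add_comm, Real.exp_add]
    _ ≤ _ := by
        gcongr
        exact exp_SnS_le_fiberSup hD hj hv

lemma BddDistortion.Wfun_le (hB : BddDistortion M g B) (hne : (SigmaA M).Nonempty)
    (hD : ∀ p : GaSp N K, p.2 ∈ SigmaA M → |g p| ≤ D) {n : ℕ}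
    {w : Fin n → Fin N} {z : ℕ → Fin N} (hz : z ∈ cyl w) :
    Wfun M g w ≤ Real.exp B * Zn M g z n := by
  refine Real.sSup_le ?_ (mul_nonneg (Real.exp_pos _).le (Zn_pos hne hD _ _).le)
  rintro _ ⟨z', hz', rfl⟩
  exact hB.Zn_le hD hz hz'

/-! ### Lower bounds for Gibbs-type measures -/

variable {μ : Measure (GaSp N K)}

lemma EquilibriumProp.exists_le_measureReal [IsFiniteMeasure μ] (h : EquilibriumProp M ν g μ) :
    ∃ C : ℝ, 0 < C ∧ ∀ (n : ℕ) (w : Fin n → Fin N) (v : Fin n → Fin K), AdmissibleWord M v →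
      Yfun M g w v / Wfun M g w * ν.real (cyl w) ≤ C * μ.real (cylP w v) := by
  obtain ⟨C, hC, h⟩ := h
  refine ⟨C, hC, fun n w v hv => ?_⟩
  have h1 := (ENNReal.ofReal_le_iff_le_toReal (measure_ne_top _ _)).1 (h n w v hv).1
  rw [mul_assoc, inv_mul_le_iff₀ hC] at h1
  exact h1

lemma EquilibriumProp.ae_mem_SigmaA [IsProbabilityMeasure ν] [IsProbabilityMeasure μ]
    (h : EquilibriumProp M ν g μ) (hne : (SigmaA M).Nonempty)
    (hg : ContinuousOn g {p : GaSp N K | p.2 ∈ SigmaA M}) (herg : Ergodic shift2 μ) :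
    ∀ᵐ p ∂μ, p.2 ∈ SigmaA M := by
  classical
  obtain ⟨D, -, hD⟩ := exists_abs_le_of_continuousOn hg
  obtain ⟨C, hC, hlow⟩ := h.exists_le_measureReal
  set adm : ∀ n, Finset ((Fin n → Fin N) × (Fin n → Fin K)) :=
    fun n => Finset.univ.filter fun q => AdmissibleWord M q.2 with hadm
  set S : ℕ → Set (GaSp N K) := fun n => ⋃ q ∈ adm n, cylP q.1 q.2 with hS
  have hmemS : ∀ n p, p ∈ S n ↔ AdmissibleWord M fun k : Fin n => p.2 k := by
    intro n p
    simp only [hS, hadm, mem_iUnion, Finset.mem_filter, Finset.mem_univ, true_and, exists_prop]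
    constructor
    · rintro ⟨q, hq, hp⟩
      rwa [show (fun k : Fin n => p.2 k) = q.2 from funext hp.2]
    · exact fun hp => ⟨(fun k => p.1 k, fun k => p.2 k), hp, fun _ => rfl, fun _ => rfl⟩
  have hSmeas : ∀ n, MeasurableSet (S n) := fun n =>
    Finset.measurableSet_biUnion _ fun q _ => measurableSet_cylP q.1 q.2
  have hanti : Antitone S := by
    intro n m hnm p hp
    rw [hmemS] at hp ⊢
    obtain ⟨j, hj, hjv⟩ := hp
    exact ⟨j, hj, fun k => hjv ⟨k, k.2.trans_le hnm⟩⟩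
  have hinter : ⋂ n, S n ⊆ {p : GaSp N K | p.2 ∈ SigmaA M} := by
    intro p hp k
    obtain ⟨j, hj, hjv⟩ := (hmemS (k + 2) p).1 (mem_iInter.1 hp (k + 2))
    have h0 : j k = p.2 k := hjv ⟨k, by omega⟩
    have h1 : j (k + 1) = p.2 (k + 1) := hjv ⟨k + 1, by omega⟩
    rw [← h0, ← h1]
    exact hj k
  have hcyl : ∀ n (w : Fin n → Fin N), ν.real (cyl w) ≤
      ∑ v : Fin n → Fin K, if AdmissibleWord M v then C * μ.real (cylP w v) else 0 := by
    intro n w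
    rcases (cyl w).eq_empty_or_nonempty with he | ⟨z, hz⟩
    · rw [he, measureReal_empty]
      refine Finset.sum_nonneg fun v _ => ?_
      split_ifs <;> positivity
    · have hW : 0 < Wfun M g w := (Zn_pos hne hD z n).trans_le (Zn_le_Wfun hD hz)
      calc ν.real (cyl w) = Wfun M g w / Wfun M g w * ν.real (cyl w) := by
            rw [div_self hW.ne', one_mul]
        _ ≤ (∑ v : Fin n → Fin K, Yfun M g w v) / Wfun M g w * ν.real (cyl w) := by
            gcongr
            exact Wfun_le_sum_Yfun hD w
        _ = ∑ v : Fin n → Fin K, Yfun M g w v / Wfun M g w * ν.real (cyl w) := by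
            rw [Finset.sum_div, Finset.sum_mul]
        _ ≤ _ := by
            refine Finset.sum_le_sum fun v _ => ?_
            split_ifs with hv
            · exact hlow n w v hv
            · rw [Yfun_eq_zero hv, zero_div, zero_mul]
  have hSlow : ∀ n, C⁻¹ ≤ μ.real (S n) := by
    intro n
    have h1 : ∑ w : Fin n → Fin N, ν.real (cyl w) = 1 := by
      simpa using sum_setIntegral_cyl (integrable_const (μ := ν) (1 : ℝ)) n
    have h2 : μ.real (S n) = ∑ q ∈ adm n, μ.real (cylP q.1 q.2) :=
      measureReal_biUnion_finset (fun q _ q' _ hq => pairwise_disjoint_cylP n hq)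
        fun q _ => measurableSet_cylP q.1 q.2
    rw [inv_le_iff_one_le_mul₀' hC, h2, ← h1, hadm, Finset.mul_sum, Finset.sum_filter,
      Fintype.sum_prod_type]
    exact Finset.sum_le_sum fun w _ => hcyl n w
  have hpos : μ {p : GaSp N K | p.2 ∈ SigmaA M} ≠ 0 := by
    have hlim := tendsto_measure_iInter_atTop (μ := μ)
      (fun n => (hSmeas n).nullMeasurableSet) hanti ⟨0, measure_ne_top _ _⟩
    have hle : ENNReal.ofReal C⁻¹ ≤ μ (⋂ n, S n) :=
      ge_of_tendsto' hlim fun n =>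
        (ENNReal.ofReal_le_iff_le_toReal (measure_ne_top _ _)).2 (hSlow n)
    exact ((ENNReal.ofReal_pos.2 (inv_pos.2 hC)).trans_le (hle.trans (measure_mono hinter))).ne'
  have hsub : {p : GaSp N K | p.2 ∈ SigmaA M} ⊆ shift2 ⁻¹' {p : GaSp N K | p.2 ∈ SigmaA M} :=
    fun p hp => shift_iterate_mem_SigmaA hp 1
  rcases herg.ae_empty_or_univ_of_ae_le_preimage
    (isClosed_setOf_snd_mem_SigmaA M).measurableSet.nullMeasurableSet
    hsub.eventuallyLE with h0 | h1
  · exact (hpos (by rw [measure_congr h0, measure_empty])).elim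
  · exact eventuallyEq_univ.1 h1

/-! ### Comparing partition functions with exponential moments of Birkhoff sums -/

variable {φ : GaSp N K → ℝ} {E C t : ℝ}

lemma ContinuousOn.integrable_of_ae_mem_SigmaA [IsFiniteMeasure μ]
    (hφ : ContinuousOn φ {p : GaSp N K | p.2 ∈ SigmaA M}) (hμ : ∀ᵐ p ∂μ, p.2 ∈ SigmaA M) :
    Integrable φ μ := by
  have h := hφ.integrableOn_compact (μ := μ) (isClosed_setOf_snd_mem_SigmaA M).isCompact
  rwa [IntegrableOn,
    Measure.restrict_eq_self_of_ae_mem (s := {p : GaSp N K | p.2 ∈ SigmaA M}) hμ] at h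

lemma continuousOn_SnS (hφ : ContinuousOn φ {p : GaSp N K | p.2 ∈ SigmaA M}) (n : ℕ) :
    ContinuousOn (SnS φ n) {p : GaSp N K | p.2 ∈ SigmaA M} := by
  refine continuousOn_finsetSum _ fun k _ =>
    hφ.comp (continuous_shift2.iterate k).continuousOn fun p hp => ?_
  rw [shift2_iterate]
  exact shift_iterate_mem_SigmaA hp k

lemma SnS_add_const_mul (g φ : GaSp N K → ℝ) (t : ℝ) (n : ℕ) (p : GaSp N K) :
    SnS (fun p => g p + t * φ p) n p = SnS g n p + t * SnS φ n p := by
  simp only [SnS, Finset.sum_add_distrib, Finset.mul_sum]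

lemma BddDistortion.const_mul_le (hE : BddDistortion M φ E) (ht : |t| ≤ 1) {n : ℕ}
    {p q : GaSp N K} (hp : p.2 ∈ SigmaA M) (hq : q.2 ∈ SigmaA M)
    (h1 : ∀ k < n, p.1 k = q.1 k) (h2 : ∀ k < n, p.2 k = q.2 k) :
    t * SnS φ n p ≤ t * SnS φ n q + E := by
  have ha := hE n p q hp hq h1 h2
  have hb := hE n q p hq hp (fun k hk => (h1 k hk).symm) fun k hk => (h2 k hk).symm
  have habs : |SnS φ n p - SnS φ n q| ≤ E := abs_le.2 ⟨by linarith, by linarith⟩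
  have h : t * (SnS φ n p - SnS φ n q) ≤ 1 * E :=
    (le_abs_self _).trans (by rw [abs_mul]; exact mul_le_mul ht habs (abs_nonneg _) zero_le_one)
  linarith

lemma exp_mul_measureReal_cylP_le [IsFiniteMeasure μ] (hμ : ∀ᵐ p ∂μ, p.2 ∈ SigmaA M)
    (hφ : ContinuousOn φ {p : GaSp N K | p.2 ∈ SigmaA M})
    (hE : BddDistortion M φ E) (ht : |t| ≤ 1) {n : ℕ} {w : Fin n → Fin N} {v : Fin n → Fin K}
    {q : GaSp N K} (hqw : q ∈ cylP w v) (hq : q.2 ∈ SigmaA M) :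
    Real.exp (t * SnS φ n q) * μ.real (cylP w v) ≤
      Real.exp E * ∫ p in cylP w v, Real.exp (t * SnS φ n p) ∂μ := by
  have hint : Integrable (fun p => Real.exp (t * SnS φ n p)) μ :=
    ((continuousOn_SnS hφ n).const_mul t).rexp.integrable_of_ae_mem_SigmaA hμ
  rw [← integral_const_mul, mul_comm, ← smul_eq_mul, ← setIntegral_const]
  refine integral_mono_ae (integrable_const _) (hint.const_mul _).integrableOn ?_
  rw [EventuallyLE, ae_restrict_iff' (measurableSet_cylP w v)]
  filter_upwards [hμ] with p hp hpw
  rw [← Real.exp_add, add_comm]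
  exact Real.exp_le_exp.2 <| hE.const_mul_le ht hq hp
    (fun k hk => (hqw.1 ⟨k, hk⟩).trans (hpw.1 ⟨k, hk⟩).symm)
    fun k hk => (hqw.2 ⟨k, hk⟩).trans (hpw.2 ⟨k, hk⟩).symm

lemma measureReal_cyl_mul_fiberSup_le [IsFiniteMeasure μ] (hμ : ∀ᵐ p ∂μ, p.2 ∈ SigmaA M)
    (hne : (SigmaA M).Nonempty) (hD : ∀ p : GaSp N K, p.2 ∈ SigmaA M → |g p| ≤ D)
    (hB : BddDistortion M g B) (hφ : ContinuousOn φ {p : GaSp N K | p.2 ∈ SigmaA M})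
    (hE : BddDistortion M φ E) (hC : 0 ≤ C)
    (hlow : ∀ (n : ℕ) (w : Fin n → Fin N) (v : Fin n → Fin K), AdmissibleWord M v →
      Yfun M g w v / Wfun M g w * ν.real (cyl w) ≤ C * μ.real (cylP w v))
    (ht : |t| ≤ 1) {n : ℕ} {w : Fin n → Fin N} {z : ℕ → Fin N} (hz : z ∈ cyl w)
    (v : Fin n → Fin K) :
    ν.real (cyl w) * fiberSup M (fun p => g p + t * φ p) z v ≤
      C * Real.exp (B + 2 * E) * Zn M g z n * ∫ p in cylP w v, Real.exp (t * SnS φ n p) ∂μ := by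
  have hZ := Zn_pos hne hD z n
  by_cases hv : AdmissibleWord M v
  swap
  · rw [fiberSup_eq_zero hv, mul_zero]
    have : 0 ≤ ∫ p in cylP w v, Real.exp (t * SnS φ n p) ∂μ :=
      integral_nonneg fun p => (Real.exp_pos _).le
    positivity
  have hlowv := hlow n w v hv
  obtain ⟨x, hx, hxv⟩ := hv
  have hW : 0 < Wfun M g w := hZ.trans_le (Zn_le_Wfun hD hz)
  have hY := Yfun_nonneg (M := M) (g := g) w v
  have h1 : fiberSup M (fun p => g p + t * φ p) z v ≤
      Yfun M g w v * Real.exp (t * SnS φ n (z, x) + E) := by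
    refine fiberSup_le (mul_nonneg hY (Real.exp_pos _).le) fun j hj hjv => ?_
    rw [SnS_add_const_mul, Real.exp_add]
    refine mul_le_mul (exp_SnS_le_Yfun hD hz hj hjv) (Real.exp_le_exp.2 ?_)
      (Real.exp_pos _).le hY
    exact hE.const_mul_le (p := (z, j)) (q := (z, x)) ht hj hx (fun _ _ => rfl)
      fun k hk => (hjv ⟨k, hk⟩).trans (hxv ⟨k, hk⟩).symm
  calc ν.real (cyl w) * fiberSup M (fun p => g p + t * φ p) z v
      ≤ ν.real (cyl w) * (Yfun M g w v * Real.exp (t * SnS φ n (z, x) + E)) := by gcongr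
    _ = Yfun M g w v / Wfun M g w * ν.real (cyl w) *
          (Wfun M g w * Real.exp (t * SnS φ n (z, x) + E)) := by
        field_simp
    _ ≤ C * μ.real (cylP w v) *
          (Real.exp B * Zn M g z n * Real.exp (t * SnS φ n (z, x) + E)) := by
        gcongr
        exact hB.Wfun_le hne hD hz
    _ = C * Real.exp B * Real.exp E * Zn M g z n *
          (Real.exp (t * SnS φ n (z, x)) * μ.real (cylP w v)) := by
        rw [Real.exp_add]
        ring
    _ ≤ C * Real.exp B * Real.exp E * Zn M g z n *
          (Real.exp E * ∫ p in cylP w v, Real.exp (t * SnS φ n p) ∂μ) := by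
        refine mul_le_mul_of_nonneg_left ?_ (by positivity)
        exact exp_mul_measureReal_cylP_le hμ hφ hE ht ⟨hz, hxv⟩ hx
    _ = _ := by
        rw [Real.exp_add, two_mul, Real.exp_add]
        ring

lemma integral_Zn_div_Zn_le [IsFiniteMeasure ν] [IsFiniteMeasure μ]
    (hμ : ∀ᵐ p ∂μ, p.2 ∈ SigmaA M) (hne : (SigmaA M).Nonempty)
    (hg : ContinuousOn g {p : GaSp N K | p.2 ∈ SigmaA M}) (hB : BddDistortion M g B)
    (hφ : ContinuousOn φ {p : GaSp N K | p.2 ∈ SigmaA M})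
    (hE : BddDistortion M φ E) (hC : 0 ≤ C)
    (hlow : ∀ (n : ℕ) (w : Fin n → Fin N) (v : Fin n → Fin K), AdmissibleWord M v →
      Yfun M g w v / Wfun M g w * ν.real (cyl w) ≤ C * μ.real (cylP w v))
    (ht : |t| ≤ 1) (n : ℕ) :
    Integrable (fun z => Zn M (fun p => g p + t * φ p) z n / Zn M g z n) ν ∧
    ∫ z, Zn M (fun p => g p + t * φ p) z n / Zn M g z n ∂ν ≤
      C * Real.exp (B + 2 * E) * ∫ p, Real.exp (t * SnS φ n p) ∂μ := by
  obtain ⟨D, -, hD⟩ := exists_abs_le_of_continuousOn hg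
  have hZ := fun z => Zn_pos (w := z) hne hD n
  have hint : Integrable (fun p => Real.exp (t * SnS φ n p)) μ :=
    ((continuousOn_SnS hφ n).const_mul t).rexp.integrable_of_ae_mem_SigmaA hμ
  have hratio : Integrable (fun z => Zn M (fun p => g p + t * φ p) z n / Zn M g z n) ν :=
    ((continuous_Zn (hg.add (hφ.const_mul t)) n).div (continuous_Zn hg n)
      fun z => (hZ z).ne').integrable_of_hasCompactSupport (HasCompactSupport.of_compactSpace _)
  refine ⟨hratio, ?_⟩
  rw [← sum_setIntegral_cyl hratio n, ← sum_setIntegral_cylP hint n, Finset.mul_sum]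
  refine Finset.sum_le_sum fun w _ => ?_
  set I := ∑ v : Fin n → Fin K, ∫ p in cylP w v, Real.exp (t * SnS φ n p) ∂μ with hI
  have hI0 : 0 ≤ I := Finset.sum_nonneg fun v _ => integral_nonneg fun p => (Real.exp_pos _).le
  have hbound : ∀ z ∈ cyl w, ν.real (cyl w) * (Zn M (fun p => g p + t * φ p) z n / Zn M g z n) ≤
      C * Real.exp (B + 2 * E) * I := by
    intro z hz
    rw [← mul_div_assoc, div_le_iff₀ (hZ z), Zn_eq_sum_fiberSup, Finset.mul_sum, hI,
      mul_right_comm, Finset.mul_sum]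
    exact Finset.sum_le_sum fun v _ =>
      measureReal_cyl_mul_fiberSup_le hμ hne hD hB hφ hE hC hlow ht hz v
  rcases eq_or_ne (ν.real (cyl w)) 0 with h0 | h0
  · rw [Measure.restrict_eq_zero.2 ((measureReal_eq_zero_iff).1 h0), integral_zero_measure]
    positivity
  · have hpos : 0 < ν.real (cyl w) := lt_of_le_of_ne measureReal_nonneg h0.symm
    calc _ ≤ ∫ _ in cyl w, C * Real.exp (B + 2 * E) * I / ν.real (cyl w) ∂ν := by
          refine setIntegral_mono_on hratio.integrableOn (integrable_const _)
            (measurableSet_cyl w) fun z hz => ?_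
          rw [le_div_iff₀' hpos]
          exact hbound z hz
      _ = _ := by
          rw [setIntegral_const, smul_eq_mul]
          field_simp

lemma integral_log_Zn_add_le [IsProbabilityMeasure ν] [IsFiniteMeasure μ]
    (hμ : ∀ᵐ p ∂μ, p.2 ∈ SigmaA M) (hne : (SigmaA M).Nonempty)
    (hg : ContinuousOn g {p : GaSp N K | p.2 ∈ SigmaA M}) (hB : BddDistortion M g B)
    (hφ : ContinuousOn φ {p : GaSp N K | p.2 ∈ SigmaA M})
    (hE : BddDistortion M φ E) (hC : 0 ≤ C)
    (hlow : ∀ (n : ℕ) (w : Fin n → Fin N) (v : Fin n → Fin K), AdmissibleWord M v →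
      Yfun M g w v / Wfun M g w * ν.real (cyl w) ≤ C * μ.real (cylP w v))
    (ht : |t| ≤ 1) (n : ℕ) (a : ℝ) :
    ∫ w, Real.log (Zn M (fun p => g p + t * φ p) w n) ∂ν ≤
      ∫ w, Real.log (Zn M g w n) ∂ν + t * (n * a) +
        C * Real.exp (B + 2 * E) * ∫ p, Real.exp (t * (SnS φ n p - n * a)) ∂μ := by
  have hh : ContinuousOn (fun p => g p + t * φ p) {p : GaSp N K | p.2 ∈ SigmaA M} :=
    hg.add (hφ.const_mul t)
  obtain ⟨D, -, hD⟩ := exists_abs_le_of_continuousOn hg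
  obtain ⟨D', -, hD'⟩ := exists_abs_le_of_continuousOn hh
  obtain ⟨hratio, hle⟩ := integral_Zn_div_Zn_le hμ hne hg hB hφ hE hC hlow ht n
  have hlogg := integrable_log_Zn (ν := ν) hne hg n
  have hmono : ∫ w, Real.log (Zn M (fun p => g p + t * φ p) w n) ∂ν ≤
      ∫ w, (Real.log (Zn M g w n) + t * (n * a) + Real.exp (-(t * (n * a))) *
        (Zn M (fun p => g p + t * φ p) w n / Zn M g w n)) ∂ν := by
    refine integral_mono (integrable_log_Zn hne hh n)
      ((hlogg.add (integrable_const _)).add (hratio.const_mul _)) fun w => ?_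
    have hpos := div_pos (Zn_pos hne hD' w n) (Zn_pos hne hD w n)
    have h := Real.log_le_self (mul_pos (Real.exp_pos (-(t * (n * a)))) hpos).le
    rw [Real.log_mul (Real.exp_pos _).ne' hpos.ne', Real.log_exp,
      Real.log_div (Zn_pos hne hD' w n).ne' (Zn_pos hne hD w n).ne'] at h
    dsimp only
    linarith
  have hconst : Integrable (fun _ => t * (n * a)) ν := integrable_const _
  have hadd : Integrable (fun w => Real.log (Zn M g w n) + t * (n * a)) ν := hlogg.add hconst
  rw [integral_add hadd (hratio.const_mul _), integral_add hlogg hconst, integral_const_mul, integral_const,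
    probReal_univ, one_smul] at hmono
  refine hmono.trans (add_le_add_right ?_ _)
  have hexp : ∀ p, Real.exp (t * (SnS φ n p - n * a)) =
      Real.exp (-(t * (n * a))) * Real.exp (t * SnS φ n p) := by
    intro p
    rw [← Real.exp_add]
    ring_nf
  simp only [hexp, integral_const_mul]
  rw [mul_left_comm (C * Real.exp (B + 2 * E))]
  exact mul_le_mul_of_nonneg_left hle (Real.exp_pos _).le

/-! ### Exponential moments of Birkhoff sums over short ranges -/

lemma exp_abs_le_two_add {A R x : ℝ} (hA : 0 < A) (hR : |x| ≤ R) :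
    Real.exp (A * |x|) ≤ 2 + (A / Real.log 2) ^ 2 * Real.exp (A * R) * x ^ 2 := by
  have hlog := Real.log_pos one_lt_two
  rcases le_or_gt (A * |x|) (Real.log 2) with h | h
  · have h1 := Real.exp_le_exp.2 h
    rw [Real.exp_log two_pos] at h1
    have : 0 ≤ (A / Real.log 2) ^ 2 * Real.exp (A * R) * x ^ 2 := by positivity
    linarith
  · have h1 : 1 ≤ (A / Real.log 2) ^ 2 * x ^ 2 := by
      rw [← sq_abs x, ← mul_pow]
      refine one_le_pow₀ ?_
      rw [div_mul_eq_mul_div, one_le_div hlog]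
      exact h.le
    have h2 : Real.exp (A * |x|) ≤ Real.exp (A * R) := by gcongr
    calc Real.exp (A * |x|) ≤ 1 * Real.exp (A * R) := by rwa [one_mul]
      _ ≤ (A / Real.log 2) ^ 2 * x ^ 2 * Real.exp (A * R) := by gcongr
      _ ≤ _ := by linarith

lemma Ergodic.exists_integral_exp_le_three [IsProbabilityMeasure μ] (herg : Ergodic shift2 μ)
    (hμ : ∀ᵐ p ∂μ, p.2 ∈ SigmaA M)
    (hφ : ContinuousOn φ {p : GaSp N K | p.2 ∈ SigmaA M}) {A : ℝ} (hA : 0 < A) :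
    ∃ n₀ : ℕ, 0 < n₀ ∧ ∀ n ≥ n₀, ∀ t : ℝ, |t| * n ≤ A →
      ∫ p, Real.exp (t * (SnS φ n p - n * ∫ q, φ q ∂μ)) ∂μ ≤ 3 := by
  obtain ⟨D, hD0, hD⟩ := exists_abs_le_of_continuousOn hφ
  set a := ∫ q, φ q ∂μ with ha
  have hmem : MemLp φ 2 μ :=
    MemLp.of_bound (hφ.integrable_of_ae_mem_SigmaA hμ).aestronglyMeasurable D
      (by filter_upwards [hμ] with p hp using hD p hp)
  set c := (A / Real.log 2) ^ 2 * Real.exp (A * (D + |a|)) with hc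
  have hlim : Tendsto (fun n : ℕ => c * ∫ p, (SnS φ n p / n - a) ^ 2 ∂μ) atTop (nhds 0) := by
    simpa [SnS, ha] using (herg.tendsto_integral_sq_average_sub hmem).const_mul c
  obtain ⟨n₀, hn₀⟩ := eventually_atTop.1 (hlim.eventually_le_const one_pos)
  refine ⟨n₀ + 1, Nat.succ_pos _, fun n hn t ht => ?_⟩
  have hnpos : (0 : ℝ) < n := by
    have : 0 < n := by omega
    exact_mod_cast this
  have hcont := continuousOn_SnS hφ n
  have hint1 : Integrable (fun p => Real.exp (t * (SnS φ n p - n * a))) μ :=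
    ((hcont.sub continuousOn_const).const_mul t).rexp.integrable_of_ae_mem_SigmaA hμ
  have hint2 : Integrable (fun p => (SnS φ n p / n - a) ^ 2) μ :=
    (((hcont.div_const _).sub continuousOn_const).pow 2).integrable_of_ae_mem_SigmaA hμ
  calc ∫ p, Real.exp (t * (SnS φ n p - n * a)) ∂μ
      ≤ ∫ p, (2 + c * (SnS φ n p / n - a) ^ 2) ∂μ := by
        refine integral_mono_ae hint1 ((integrable_const _).add (hint2.const_mul c)) ?_
        filter_upwards [hμ] with p hp
        have hx : |SnS φ n p / n - a| ≤ D + |a| := by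
          refine (abs_sub _ _).trans (add_le_add_left ?_ _)
          rw [abs_div, Nat.abs_cast, div_le_iff₀ hnpos, mul_comm]
          exact abs_SnS_le hD n hp
        refine le_trans (Real.exp_le_exp.2 ?_) (exp_abs_le_two_add hA hx)
        calc t * (SnS φ n p - n * a) ≤ |t * n * (SnS φ n p / n - a)| := by
              refine le_trans (le_of_eq ?_) (le_abs_self _)
              field_simp
          _ = |t| * n * |SnS φ n p / n - a| := by rw [abs_mul, abs_mul, Nat.abs_cast]
          _ ≤ _ := by gcongr
    _ = 2 + c * ∫ p, (SnS φ n p / n - a) ^ 2 ∂μ := by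
        rw [integral_add (integrable_const _) (hint2.const_mul c), integral_const_mul]
        simp
    _ ≤ 3 := by linarith [hn₀ n (by omega)]

/-! ### Differentiability of the conditional pressure -/

lemma ApIrr.exists_condPressure_add_le [IsProbabilityMeasure ν] [IsProbabilityMeasure μ]
    (hA : ApIrr M) (hne : (SigmaA M).Nonempty) (hinv : MeasurePreserving shift ν ν)
    (herg : Ergodic shift2 μ) (hprop : EquilibriumProp M ν g μ)
    (hg : ContinuousOn g {p : GaSp N K | p.2 ∈ SigmaA M}) (hB0 : 0 ≤ B)
    (hB : BddDistortion M g B) (hφ : ContinuousOn φ {p : GaSp N K | p.2 ∈ SigmaA M})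
    (hE : BddDistortion M φ E) {ε : ℝ} (hε : 0 < ε) :
    ∃ δ : ℝ, 0 < δ ∧ ∀ t : ℝ, |t| ≤ δ → condPressure M ν (fun p => g p + t * φ p) ≤
      condPressure M ν g + t * (∫ p, φ p ∂μ) + ε * |t| := by
  obtain ⟨C, hC, hlow⟩ := hprop.exists_le_measureReal
  obtain ⟨c, hc, hcn⟩ := hA.exists_div_le_condPressure hne hinv hg hB0 hB
  have hμ := hprop.ae_mem_SigmaA hne hg herg
  set a := ∫ p, φ p ∂μ with ha
  set G := c + C * Real.exp (B + 2 * E) * 3 with hG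
  have hGpos : 0 < G := by positivity
  obtain ⟨n₀, hn₀, hexp⟩ := herg.exists_integral_exp_le_three hμ hφ
    (A := G / ε + 1) (by positivity)
  have hn₀' : (0 : ℝ) < n₀ := by exact_mod_cast hn₀
  refine ⟨min 1 (G / ε / n₀), by positivity, fun t ht => ?_⟩
  rcases eq_or_ne t 0 with rfl | ht0
  · simp
  have htpos : 0 < |t| := abs_pos.2 ht0
  have ht1 : |t| ≤ 1 := ht.trans (min_le_left _ _)
  set n := ⌈G / ε / |t|⌉₊ with hn
  have hceil : G / ε / |t| ≤ n := Nat.le_ceil _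
  have hnpos : (0 : ℝ) < n := (by positivity : 0 < G / ε / |t|).trans_le hceil
  have hn0 : n ≠ 0 := by
    rintro h
    simp [h] at hnpos
  have hnn₀ : n₀ ≤ n := by
    have h := ht.trans (min_le_right _ _)
    rw [le_div_iff₀ hn₀', mul_comm, ← le_div_iff₀ htpos] at h
    exact_mod_cast h.trans hceil
  have htn : |t| * n ≤ G / ε + 1 := by
    have h := (Nat.ceil_lt_add_one (by positivity : 0 ≤ G / ε / |t|)).le
    calc |t| * n ≤ |t| * (G / ε / |t| + 1) := by gcongr
      _ = G / ε + |t| := by field_simp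
      _ ≤ _ := by linarith
  have hh : ContinuousOn (fun p => g p + t * φ p) {p : GaSp N K | p.2 ∈ SigmaA M} :=
    hg.add (hφ.const_mul t)
  have h1 := condPressure_le_div hne hinv hh hn0
  have h2 := integral_log_Zn_add_le hμ hne hg hB hφ hE hC.le hlow ht1 n a
  have h3 := mul_le_mul_of_nonneg_left (hexp n hnn₀ t htn)
    (by positivity : 0 ≤ C * Real.exp (B + 2 * E))
  have h4 := hcn n hn0
  have h5 : G ≤ ε * |t| * n := by
    rw [div_div, div_le_iff₀ (by positivity)] at hceil
    linarith
  rw [le_div_iff₀ hnpos] at h1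
  rw [div_le_iff₀ hnpos] at h4
  refine le_of_mul_le_mul_right ?_ hnpos
  linarith

lemma ApIrr.hasDerivAt_condPressure [IsProbabilityMeasure ν] [IsProbabilityMeasure μ]
    (hA : ApIrr M) (hne : (SigmaA M).Nonempty) (hinv : MeasurePreserving shift ν ν)
    (herg : Ergodic shift2 μ) (hprop : EquilibriumProp M ν g μ)
    (hg : ContinuousOn g {p : GaSp N K | p.2 ∈ SigmaA M}) (hB0 : 0 ≤ B)
    (hB : BddDistortion M g B) (hφ : ContinuousOn φ {p : GaSp N K | p.2 ∈ SigmaA M})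
    (hE : BddDistortion M φ E) :
    HasDerivAt (fun t : ℝ => condPressure M ν (fun p => g p + t * φ p)) (∫ p, φ p ∂μ) 0 := by
  rw [hasDerivAt_iff_isLittleO, Asymptotics.isLittleO_iff]
  intro ε hε
  obtain ⟨δ, hδ, hle⟩ :=
    hA.exists_condPressure_add_le hne hinv herg hprop hg hB0 hB hφ hE hε
  filter_upwards [Metric.closedBall_mem_nhds (0 : ℝ) hδ] with t ht
  rw [Metric.mem_closedBall, dist_zero_right, Real.norm_eq_abs] at ht
  have hup := hle t ht
  have hdown := hle (-t) (by rwa [abs_neg])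
  have hconv := two_mul_condPressure_le (g := fun p => g p + t * φ p)
    (h := fun p => g p + -t * φ p) hne hinv (hg.add (hφ.const_mul t))
    (hg.add (hφ.const_mul (-t)))
  have hmid : (fun p => (g p + t * φ p + (g p + -t * φ p)) / 2) = g := by
    funext p
    ring
  rw [hmid] at hconv
  rw [abs_neg] at hdown
  simp only [zero_mul, add_zero, sub_zero, smul_eq_mul, Real.norm_eq_abs]
  rw [abs_le]
  constructor <;> linarith

lemma BddDistortion.sub {f : GaSp N K → ℝ} (hf : BddDistortion M f E) (hg : BddDistortion M g B) :
    BddDistortion M (fun p => f p - g p) (E + B) := by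
  intro n p q hp hq h1 h2
  have hfn := hf n p q hp hq h1 h2
  have hgn := hg n q p hq hp (fun k hk => (h1 k hk).symm) fun k hk => (h2 k hk).symm
  simp only [SnS, Finset.sum_sub_distrib] at hfn hgn ⊢
  linarith

end SymbolicDynamics

theorem conditional_pressure_differentiable
    {N K : ℕ} (M : Fin K → Fin K → Bool) (hA : ApIrr M)
    (ν : Measure (ℕ → Fin N)) [IsProbabilityMeasure ν]
    (hinv : MeasurePreserving shift ν ν) (herg : Ergodic shift ν)
    (hqb : QuasiBernoulli ν)
    (f g : GaSp N K → ℝ)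
    (hf : ContinuousOn f {p : GaSp N K | p.2 ∈ SigmaA M}) (hbf : BddVar M f)
    (hg : ContinuousOn g {p : GaSp N K | p.2 ∈ SigmaA M}) (hbg : BddVar M g)
    (μg : Measure (GaSp N K)) [IsProbabilityMeasure μg]
    (hergμ : Ergodic shift2 μg) (hprop : EquilibriumProp M ν g μg)
    (huniq : ∀ μ' : Measure (GaSp N K), IsProbabilityMeasure μ' → Ergodic shift2 μ' →
      EquilibriumProp M ν g μ' → μ' = μg) :
    HasDerivAt (fun t : ℝ => condPressure M ν (fun p => (1 - t) * g p + t * f p))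
      (∫ p, (f p - g p) ∂μg) 0 := by
  obtain ⟨p⟩ : Nonempty (GaSp N K) := Measure.nonempty_of_neZero μg
  have hne : (SigmaA M).Nonempty := hA.nonempty_SigmaA (p.2 0)
  obtain ⟨Df, -, hDf⟩ := exists_abs_le_of_continuousOn hf
  obtain ⟨Dg, -, hDg⟩ := exists_abs_le_of_continuousOn hg
  obtain ⟨Bf, -, hBf⟩ := hbf.exists_bddDistortion hDf
  obtain ⟨Bg, hBg0, hBg⟩ := hbg.exists_bddDistortion hDg
  have hpath : ∀ t : ℝ, (fun p => (1 - t) * g p + t * f p) = fun p => g p + t * (f p - g p) := by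
    intro t
    funext p
    ring
  simp only [hpath]
  exact hA.hasDerivAt_condPressure hne hinv hergμ hprop hg hBg0 hBg (hf.sub hg) (hBf.sub hBg)
end
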